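/- arXiv:1705.04372 — 3 statements merged into one kernel-verified Lean document; each statement's English description precedes it below -/
import Mathlib

section
/- Let q₀ ≥ 19 be a real number. There is no covering system of the integers all of whose moduli have every prime factor greater than q₀. Equivalently: if S is a finite set of integers, each greater than 1, such that every prime p dividing some m ∈ S satisfies p > q₀, then for every choice of residues a : S → ℤ the union of the residue classes a_m mod m (for m ∈ S) is not all of ℤ. -/
open Finset

theorem sum_range_mul_of_coprime {M q : ℕ} (hM : 0 < M) (hq : 0 < q) (h : M.Coprime q)
    (F : ℕ → ℕ → ℝ) :
    ∑ z ∈ range (q * M), F (z % M) (z % q) = ∑ x ∈ range M, ∑ y ∈ range q, F x y := by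
  rw [← Finset.sum_product']
  refine Finset.sum_nbij' (fun z => (z % M, z % q))
    (fun u => (Nat.chineseRemainder h u.1 u.2 : ℕ)) ?_ ?_ ?_ ?_ ?_
  · intro z _
    simp [Nat.mod_lt, hM, hq]
  · intro u _
    simpa [mul_comm] using Nat.chineseRemainder_lt_mul h u.1 u.2 hM.ne' hq.ne'
  · intro z hz
    have hz' : z < M * q := by simpa [mul_comm] using hz
    have := Nat.chineseRemainder_modEq_unique h (a := z % M) (b := z % q) (z := z)
      (Nat.mod_modEq _ _).symm (Nat.mod_modEq _ _).symm
    have h2 := Nat.chineseRemainder_lt_mul h (z % M) (z % q) hM.ne' hq.ne'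
    exact (Nat.ModEq.eq_of_lt_of_lt this hz' h2).symm
  · rintro ⟨x, y⟩ hu
    simp only [mem_product, mem_range] at hu
    have h1 := (Nat.chineseRemainder h x y).2
    ext
    · exact Nat.mod_eq_of_modEq h1.1 hu.1
    · exact Nat.mod_eq_of_modEq h1.2 hu.2
  · intro z _
    rfl

theorem exists_redistribution {Y B : Finset ℕ} (hY : Y.Nonempty) (hB : B ⊆ Y) {δ : ℝ}
    (h0 : 0 < δ) (h1 : δ < 1) :
    ∃ f : ℕ → ℝ, (∀ y, 0 ≤ f y) ∧ (∀ y, f y ≤ 1 / (1 - δ)) ∧ ∑ y ∈ Y, f y = #Y ∧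
      ∑ y ∈ B, f y ≤ (#B : ℝ) ^ 2 / #Y / (4 * δ * (1 - δ)) := by
  have hn : (0 : ℝ) < #Y := by exact_mod_cast hY.card_pos
  have hk : (0 : ℝ) ≤ #B := by positivity
  have hd : 0 < 1 - δ := by linarith
  have hsum (u v : ℝ) : ∑ y ∈ Y, (if y ∈ B then u else v) = #B * u + (#Y - #B) * v := by
    rw [← Finset.sum_sdiff hB, Finset.sum_congr rfl (g := fun _ => v)
      (fun y hy => if_neg (mem_sdiff.1 hy).2), Finset.sum_congr (s₁ := B) rfl (g := fun _ => u)
      (fun y hy => if_pos hy), sum_const, sum_const, nsmul_eq_mul, nsmul_eq_mul,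
      cast_card_sdiff hB]
    ring
  have hsumB (u v : ℝ) : ∑ y ∈ B, (if y ∈ B then u else v) = #B * u := by
    rw [Finset.sum_congr rfl (g := fun _ => u) (fun y hy => if_pos hy), sum_const, nsmul_eq_mul]
  generalize (#Y : ℝ) = n at *
  generalize (#B : ℝ) = k at *
  rcases le_or_gt k (δ * n) with h | h
  · have hnk : 0 < n - k := by nlinarith
    refine ⟨fun y => if y ∈ B then 0 else n / (n - k), fun y => ?_, fun y => ?_, ?_, ?_⟩
    · dsimp only; split_ifs <;> positivity
    · dsimp only
      split_ifs
      · positivity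
      · rw [div_le_div_iff₀ hnk hd]; linarith
    · rw [hsum]; field_simp; ring
    · rw [hsumB, mul_zero]; positivity
  · have hk' : 0 < k := by nlinarith [mul_pos h0 hn]
    have hkn : 0 < k - δ * n := by linarith
    refine ⟨fun y => if y ∈ B then (k - δ * n) / (k * (1 - δ)) else 1 / (1 - δ),
      fun y => ?_, fun y => ?_, ?_, ?_⟩
    · dsimp only; split_ifs <;> positivity
    · dsimp only
      split_ifs
      · rw [div_le_div_iff₀ (by positivity) hd]
        nlinarith [mul_pos (mul_pos h0 hn) hd]
      · rfl
    · rw [hsum]; field_simp; ring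
    · rw [hsumB, div_div, ← mul_div_assoc, div_le_div_iff₀ (by positivity) (by positivity)]
      have : 0 ≤ (k * (1 - δ) * k) * (k - 2 * δ * n) ^ 2 := by positivity
      have : 0 ≤ (k * (1 - δ)) * (k - 2 * δ * n) ^ 2 := by positivity
      nlinarith

theorem sum_range_prime_pow_modEq {p : ℕ} (hp : 0 < p) {t γ : ℕ} (ht : t ≤ γ) (r : ℤ) :
    (∑ y ∈ range (p ^ γ), if (y : ℤ) ≡ r [ZMOD ((p ^ t : ℕ) : ℤ)] then (1 : ℝ) else 0) =
      p ^ γ * ((p : ℝ)⁻¹) ^ t := by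
  obtain ⟨k, rfl⟩ := Nat.exists_eq_add_of_le ht
  have hpt : (0 : ℤ) < (p ^ t : ℕ) := by positivity
  have hpq : ((p ^ t : ℕ) : ℚ) ≠ 0 := by positivity
  have h1 := Int.Ico_filter_modEq_card 0 ((p ^ (t + k) : ℕ) : ℤ) hpt r
  have h2 : #((range (p ^ (t + k))).filter (fun y : ℕ => (y : ℤ) ≡ r [ZMOD ((p ^ t : ℕ) : ℤ)])) =
      #{x ∈ Ico (0 : ℤ) ((p ^ (t + k) : ℕ) : ℤ) | x ≡ r [ZMOD ((p ^ t : ℕ) : ℤ)]} := by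
    refine Finset.card_bij (fun y _ => (y : ℤ)) ?_ ?_ ?_
    · intro y hy
      simp only [mem_filter, mem_range, mem_Ico] at hy ⊢
      exact ⟨⟨Int.natCast_nonneg y, by exact_mod_cast hy.1⟩, hy.2⟩
    · intro x _ y _ h
      exact_mod_cast h
    · intro z hz
      simp only [mem_filter, mem_Ico] at hz
      lift z to ℕ using hz.1.1
      refine ⟨z, ?_, rfl⟩
      simp only [mem_filter, mem_range]
      exact ⟨by exact_mod_cast hz.1.2, hz.2⟩
  have h3 : ((((p ^ (t + k) : ℕ) : ℤ) : ℚ) - (r : ℚ)) / (((p ^ t : ℕ) : ℤ) : ℚ) =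
      (((0 : ℤ) : ℚ) - (r : ℚ)) / (((p ^ t : ℕ) : ℤ) : ℚ) + ((p ^ k : ℕ) : ℤ) := by
    push_cast at hpq ⊢
    field_simp
    ring
  rw [h3, Int.ceil_add_intCast, add_sub_cancel_left, max_eq_left (Int.natCast_nonneg _)] at h1
  rw [Finset.sum_boole, h2, show #{x ∈ Ico (0 : ℤ) ((p ^ (t + k) : ℕ) : ℤ) |
    x ≡ r [ZMOD ((p ^ t : ℕ) : ℤ)]} = p ^ k by exact_mod_cast h1]
  have : (p : ℝ) ≠ 0 := by positivity
  push_cast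
  rw [pow_add, inv_pow]
  field_simp

theorem sum_divisors_prime_pow_mul {p M : ℕ} (hp : p.Prime) (hM : ¬ p ∣ M) (γ : ℕ) (F : ℕ → ℝ) :
    ∑ m ∈ (p ^ γ * M).divisors, F m =
      ∑ t ∈ range (γ + 1), ∑ d ∈ M.divisors, F (p ^ t * d) := by
  have hc : (p ^ γ).Coprime M := ((Nat.Prime.coprime_iff_not_dvd hp).2 hM).pow_left γ
  rw [Nat.divisors_mul, Finset.mul_def, Finset.sum_image hc.mul_injOn_divisors,
    Finset.sum_product, Nat.sum_divisors_prime_pow hp]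

theorem sum_inv_pow_le {x : ℝ} (hx : 1 < x) (γ : ℕ) :
    ∑ t ∈ Icc 1 γ, (x⁻¹) ^ t ≤ 1 / (x - 1) := by
  have h : ∑ t ∈ Icc 1 γ, (x⁻¹) ^ t = (1 - (x⁻¹) ^ γ) / (x - 1) := by
    have hx0 : x - 1 ≠ 0 := by linarith
    induction γ with
    | zero => simp
    | succ n ih =>
      rw [Finset.sum_Icc_succ_top (by omega), ih, pow_succ x⁻¹ n]
      generalize (x⁻¹) ^ n = u
      field_simp
      ring
  have hx0 : 0 < x - 1 := by linarith
  rw [h]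
  gcongr
  have : 0 ≤ (x⁻¹) ^ γ := by positivity
  linarith

theorem sum_inv_pow_max_le {x : ℝ} (hx : 1 < x) (γ : ℕ) :
    ∑ s ∈ range (γ + 1), ∑ t ∈ range (γ + 1), (x⁻¹) ^ max s t ≤
      1 + (3 * x - 1) / (x - 1) ^ 2 := by
  have hx0 : 0 < x - 1 := by linarith
  have hx1 : x - 1 ≠ 0 := hx0.ne'
  have h : ∑ s ∈ range (γ + 1), ∑ t ∈ range (γ + 1), (x⁻¹) ^ max s t =
      1 + (3 * x - 1) / (x - 1) ^ 2 -
        (x⁻¹) ^ γ * ((2 * γ + 3) * x - (2 * γ + 1)) / (x - 1) ^ 2 := by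
    induction γ with
    | zero => simp
    | succ n ih =>
      have hcol : ∑ s ∈ range (n + 1), (x⁻¹) ^ max s (n + 1) = (n + 1) * (x⁻¹) ^ (n + 1) := by
        rw [Finset.sum_congr rfl (g := fun _ => (x⁻¹) ^ (n + 1))
          (fun s hs => by rw [max_eq_right (mem_range.1 hs).le])]
        simp
      have hrow : ∑ t ∈ range (n + 1), (x⁻¹) ^ max (n + 1) t = (n + 1) * (x⁻¹) ^ (n + 1) := by
        simpa only [max_comm] using hcol
      rw [Finset.sum_range_succ, Finset.sum_range_succ (n := n + 1), max_self, hrow]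
      simp_rw [Finset.sum_range_succ (n := n + 1)]
      rw [Finset.sum_add_distrib, hcol, ih, pow_succ x⁻¹ n]
      generalize (x⁻¹) ^ n = u
      push_cast
      field_simp
      ring
  rw [h, sub_le_self_iff]
  have : 0 ≤ (2 * γ + 3) * x - (2 * γ + 1 : ℝ) := by nlinarith [Nat.cast_nonneg (α := ℝ) γ]
  positivity

/-- The number of divisors `d` of `M` such that `x` lies in the class `b d mod d`. -/
def hitCount (M : ℕ) (b : ℕ → ℤ) (x : ℕ) : ℝ :=
  ∑ d ∈ M.divisors, if (x : ℤ) ≡ b d [ZMOD (d : ℤ)] then 1 else 0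

theorem hitCount_nonneg (M : ℕ) (b : ℕ → ℤ) (x : ℕ) : 0 ≤ hitCount M b x :=
  Finset.sum_nonneg fun _ _ => by split_ifs <;> norm_num

/-- `x` lies in one of the classes `a m mod m` with `m > 1` a divisor of `M`. -/
def Covered (a : ℕ → ℤ) (M x : ℕ) : Prop :=
  ∃ m ∈ M.divisors, 1 < m ∧ (x : ℤ) ≡ a m [ZMOD (m : ℤ)]

open Classical in
/-- A probability weight on the residues modulo `M` giving mass at most `β` to the covered
residues and for which second moments of counting functions are at most `D`. -/
structure IsSieveWeight (a : ℕ → ℤ) (M : ℕ) (w : ℕ → ℝ) (β D : ℝ) : Prop where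
  nonneg : ∀ x, 0 ≤ w x
  total : ∑ x ∈ range M, w x = 1
  covered : ∑ x ∈ range M, (if Covered a M x then w x else 0) ≤ β
  moment : ∀ b b' : ℕ → ℤ, ∑ x ∈ range M, w x * (hitCount M b x * hitCount M b' x) ≤ D

theorem IsSieveWeight.moment_nonneg {a : ℕ → ℤ} {M : ℕ} {w : ℕ → ℝ} {β D : ℝ}
    (h : IsSieveWeight a M w β D) : 0 ≤ D :=
  (Finset.sum_nonneg fun x _ => mul_nonneg (h.nonneg x)
    (mul_nonneg (hitCount_nonneg M a x) (hitCount_nonneg M a x))).trans (h.moment a a)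

theorem isSieveWeight_one (a : ℕ → ℤ) : IsSieveWeight a 1 (fun _ => 1) 0 1 where
  nonneg _ := zero_le_one
  total := by simp
  covered := by
    have : ¬ Covered a 1 0 := by
      rintro ⟨m, hm, h1, -⟩
      simp at hm
      omega
    simp [this]
  moment b b' := by
    have h (b : ℕ → ℤ) : hitCount 1 b 0 = 1 := by
      simp [hitCount, Int.modEq_one, -Finset.sum_boole]
    simp [h]

theorem modEq_prime_pow_mul_iff {p M t γ d : ℕ} (hp : p.Prime) (hM : ¬ p ∣ M) (ht : t ≤ γ)
    (hd : d ∣ M) (z : ℕ) (r : ℤ) :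
    (z : ℤ) ≡ r [ZMOD ((p ^ t * d : ℕ) : ℤ)] ↔
      ((z % M : ℕ) : ℤ) ≡ r [ZMOD (d : ℤ)] ∧
        ((z % p ^ γ : ℕ) : ℤ) ≡ r [ZMOD ((p ^ t : ℕ) : ℤ)] := by
  have hc : (p ^ t).Coprime d :=
    ((Nat.Prime.coprime_iff_not_dvd hp).2 fun h => hM (h.trans hd)).pow_left t
  have h1 : ((z % M : ℕ) : ℤ) ≡ z [ZMOD (d : ℤ)] :=
    Int.natCast_modEq_iff.2 ((Nat.mod_modEq z M).of_dvd hd)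
  have h2 : ((z % p ^ γ : ℕ) : ℤ) ≡ z [ZMOD ((p ^ t : ℕ) : ℤ)] :=
    Int.natCast_modEq_iff.2 ((Nat.mod_modEq z _).of_dvd (pow_dvd_pow p ht))
  rw [Nat.cast_mul, ← Int.modEq_and_modEq_iff_modEq_mul (by simpa using hc)]
  exact ⟨fun h => ⟨h1.trans h.2, h2.trans h.1⟩, fun h => ⟨h2.symm.trans h.2, h1.symm.trans h.1⟩⟩

theorem hitCount_prime_pow_mul {p M : ℕ} (hp : p.Prime) (hM : ¬ p ∣ M) (γ : ℕ) (b : ℕ → ℤ)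
    (z : ℕ) :
    hitCount (p ^ γ * M) b z = ∑ t ∈ range (γ + 1), ∑ d ∈ M.divisors,
      (if ((z % M : ℕ) : ℤ) ≡ b (p ^ t * d) [ZMOD (d : ℤ)] then (1 : ℝ) else 0) *
      (if ((z % p ^ γ : ℕ) : ℤ) ≡ b (p ^ t * d) [ZMOD ((p ^ t : ℕ) : ℤ)] then 1 else 0) := by
  rw [hitCount, sum_divisors_prime_pow_mul hp hM]
  refine Finset.sum_congr rfl fun t ht => Finset.sum_congr rfl fun d hd => ?_
  rw [ite_zero_mul_ite_zero, mul_one]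
  exact if_congr (modEq_prime_pow_mul_iff hp hM (by simpa [Nat.lt_succ_iff] using ht)
    (Nat.dvd_of_mem_divisors hd) z _) rfl rfl

/-- The part of the fibre over `x` covered by moduli divisible by `p`. -/
def fibreHits (a : ℕ → ℤ) (p γ M x : ℕ) : Finset ℕ :=
  {y ∈ range (p ^ γ) | ∃ t ∈ Icc 1 γ, ∃ d ∈ M.divisors,
    (x : ℤ) ≡ a (p ^ t * d) [ZMOD (d : ℤ)] ∧ (y : ℤ) ≡ a (p ^ t * d) [ZMOD ((p ^ t : ℕ) : ℤ)]}

theorem card_fibreHits_le (a : ℕ → ℤ) {p : ℕ} (hp : 0 < p) (γ M x : ℕ) :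
    (#(fibreHits a p γ M x) : ℝ) ≤
      p ^ γ * ∑ t ∈ Icc 1 γ, ((p : ℝ)⁻¹) ^ t * hitCount M (fun d => a (p ^ t * d)) x := by
  classical
  calc (#(fibreHits a p γ M x) : ℝ)
      ≤ ∑ y ∈ range (p ^ γ), ∑ t ∈ Icc 1 γ, ∑ d ∈ M.divisors,
        (if (x : ℤ) ≡ a (p ^ t * d) [ZMOD (d : ℤ)] then (1 : ℝ) else 0) *
        (if (y : ℤ) ≡ a (p ^ t * d) [ZMOD ((p ^ t : ℕ) : ℤ)] then 1 else 0) := by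
        rw [fibreHits, ← Finset.sum_boole]
        refine Finset.sum_le_sum fun y _ => ?_
        have hnn (t d : ℕ) : (0 : ℝ) ≤
            (if (x : ℤ) ≡ a (p ^ t * d) [ZMOD (d : ℤ)] then (1 : ℝ) else 0) *
            (if (y : ℤ) ≡ a (p ^ t * d) [ZMOD ((p ^ t : ℕ) : ℤ)] then 1 else 0) := by
          split_ifs <;> norm_num
        split_ifs with h
        · obtain ⟨t, ht, d, hd, h1, h2⟩ := h
          refine le_trans ?_ (Finset.single_le_sum
            (fun t _ => Finset.sum_nonneg fun d _ => hnn t d) ht)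
          refine le_trans ?_ (Finset.single_le_sum (fun d _ => hnn t d) hd)
          rw [if_pos h1, if_pos h2, mul_one]
        · exact Finset.sum_nonneg fun t _ => Finset.sum_nonneg fun d _ => hnn t d
    _ = _ := by
        rw [Finset.sum_comm, Finset.mul_sum]
        refine Finset.sum_congr rfl fun t ht => ?_
        rw [Finset.sum_comm, hitCount, Finset.mul_sum, Finset.mul_sum]
        refine Finset.sum_congr rfl fun d _ => ?_
        rw [← Finset.mul_sum, sum_range_prime_pow_modEq hp (mem_Icc.1 ht).2]
        ring

theorem covered_prime_pow_mul {a : ℕ → ℤ} {p M : ℕ} (hp : p.Prime) (hM : ¬ p ∣ M) {γ z : ℕ}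
    (h : Covered a (p ^ γ * M) z) :
    Covered a M (z % M) ∨ z % p ^ γ ∈ fibreHits a p γ M (z % M) := by
  obtain ⟨m, hm, h1, hz⟩ := h
  rw [Nat.divisors_mul, Finset.mem_mul] at hm
  obtain ⟨u, hu, d, hd, rfl⟩ := hm
  obtain ⟨t, ht, rfl⟩ := (Nat.mem_divisors_prime_pow hp γ).1 hu
  have hz' := (modEq_prime_pow_mul_iff hp hM ht (Nat.dvd_of_mem_divisors hd) z _).1 hz
  rcases Nat.eq_zero_or_pos t with rfl | h0
  · left
    rw [pow_zero, one_mul] at h1 hz'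
    exact ⟨d, hd, h1, hz'.1⟩
  · right
    simp only [fibreHits, mem_filter, mem_range]
    exact ⟨Nat.mod_lt _ (pow_pos hp.pos γ), t, mem_Icc.2 ⟨h0, ht⟩, d, hd, hz'⟩

theorem IsSieveWeight.sum_sq_card_fibreHits_le {a : ℕ → ℤ} {M : ℕ} {w : ℕ → ℝ} {β D : ℝ}
    (h : IsSieveWeight a M w β D) {p : ℕ} (hp : p.Prime) (γ : ℕ) :
    ∑ x ∈ range M, w x * ((#(fibreHits a p γ M x) : ℝ) / p ^ γ) ^ 2 ≤ D / ((p : ℝ) - 1) ^ 2 := by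
  have hp1 : (1 : ℝ) < p := by exact_mod_cast hp.one_lt
  have hp0 : (0 : ℝ) < p := by linarith
  calc ∑ x ∈ range M, w x * ((#(fibreHits a p γ M x) : ℝ) / p ^ γ) ^ 2
      ≤ ∑ x ∈ range M, w x *
        (∑ t ∈ Icc 1 γ, ((p : ℝ)⁻¹) ^ t * hitCount M (fun d => a (p ^ t * d)) x) ^ 2 := by
        refine Finset.sum_le_sum fun x _ => mul_le_mul_of_nonneg_left ?_ (h.nonneg x)
        refine pow_le_pow_left₀ (by positivity) ?_ 2
        rw [div_le_iff₀' (by positivity)]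
        exact card_fibreHits_le a hp.pos γ M x
    _ = ∑ s ∈ Icc 1 γ, ∑ t ∈ Icc 1 γ, ((p : ℝ)⁻¹) ^ s * ((p : ℝ)⁻¹) ^ t *
          ∑ x ∈ range M, w x * (hitCount M (fun d => a (p ^ s * d)) x *
            hitCount M (fun d => a (p ^ t * d)) x) := by
        simp_rw [sq, Finset.sum_mul_sum, Finset.mul_sum]
        rw [Finset.sum_comm]
        refine Finset.sum_congr rfl fun s _ => ?_
        rw [Finset.sum_comm]
        refine Finset.sum_congr rfl fun t _ => Finset.sum_congr rfl fun x _ => ?_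
        ring
    _ ≤ ∑ s ∈ Icc 1 γ, ∑ t ∈ Icc 1 γ, ((p : ℝ)⁻¹) ^ s * ((p : ℝ)⁻¹) ^ t * D :=
        Finset.sum_le_sum fun s _ => Finset.sum_le_sum fun t _ =>
          mul_le_mul_of_nonneg_left (h.moment _ _) (by positivity)
    _ = (∑ s ∈ Icc 1 γ, ((p : ℝ)⁻¹) ^ s) ^ 2 * D := by
        rw [sq, Finset.sum_mul_sum, Finset.sum_mul]
        simp_rw [Finset.sum_mul]
    _ ≤ (1 / ((p : ℝ) - 1)) ^ 2 * D := by
        refine mul_le_mul_of_nonneg_right ?_ h.moment_nonneg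
        exact pow_le_pow_left₀ (Finset.sum_nonneg fun _ _ => by positivity)
          (sum_inv_pow_le hp1 γ) 2
    _ = _ := by rw [div_pow, one_pow, one_div_mul_eq_div]

/-- The weight with which the pair of exponents `(s, t)` of `p` enters the second moment. -/
noncomputable def momentCoeff (δ : ℝ) (p s t : ℕ) : ℝ :=
  (1 - δ)⁻¹ * ((p : ℝ)⁻¹) ^ max s t - if s = 0 then if t = 0 then (1 - δ)⁻¹ - 1 else 0 else 0

theorem sum_momentCoeff_le {δ : ℝ} (h1 : δ < 1) {p : ℕ} (hp : 1 < p) (γ : ℕ) :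
    ∑ s ∈ range (γ + 1), ∑ t ∈ range (γ + 1), momentCoeff δ p s t ≤
      1 + (3 * (p : ℝ) - 1) / ((p : ℝ) - 1) ^ 2 / (1 - δ) := by
  have hd : 0 < (1 - δ)⁻¹ := inv_pos.2 (by linarith)
  have h := mul_le_mul_of_nonneg_left
    (sum_inv_pow_max_le (x := p) (by exact_mod_cast hp) γ) hd.le
  simp only [momentCoeff, Finset.sum_sub_distrib, ← Finset.mul_sum]
  have h2 : ∑ s ∈ range (γ + 1), ∑ t ∈ range (γ + 1),
      (if s = 0 then if t = 0 then (1 - δ)⁻¹ - 1 else 0 else 0) = (1 - δ)⁻¹ - 1 := by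
    rw [Finset.sum_eq_single 0, Finset.sum_eq_single 0] <;> simp +contextual
  rw [h2]
  refine (sub_le_sub_right h _).trans (le_of_eq ?_)
  rw [div_eq_mul_inv _ (1 - δ)]
  ring

theorem sum_mul_modEq_le_momentCoeff {δ : ℝ} (h1 : δ < 1) {p : ℕ} (hp : 0 < p) {γ s t : ℕ}
    (hs : s ≤ γ) (ht : t ≤ γ) {g : ℕ → ℝ} (hg0 : ∀ y, 0 ≤ g y) (hg : ∀ y, g y ≤ 1 / (1 - δ))
    (hsum : ∑ y ∈ range (p ^ γ), g y = p ^ γ) (r r' : ℤ) :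
    ∑ y ∈ range (p ^ γ), g y *
      ((if (y : ℤ) ≡ r [ZMOD ((p ^ s : ℕ) : ℤ)] then (1 : ℝ) else 0) *
        (if (y : ℤ) ≡ r' [ZMOD ((p ^ t : ℕ) : ℤ)] then 1 else 0)) ≤
      p ^ γ * momentCoeff δ p s t := by
  have hd : 0 < 1 - δ := by linarith
  by_cases h0 : s = 0 ∧ t = 0
  · obtain ⟨rfl, rfl⟩ := h0
    simp [momentCoeff, Int.modEq_one, hsum]
  have hc : momentCoeff δ p s t = 1 / (1 - δ) * ((p : ℝ)⁻¹) ^ max s t := by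
    rw [momentCoeff, one_div, sub_eq_self]
    split_ifs <;> simp_all
  have key {u : ℕ} (hu : u ≤ γ) (r : ℤ) (F : ℕ → ℝ)
      (hF : ∀ y, F y ≤ if (y : ℤ) ≡ r [ZMOD ((p ^ u : ℕ) : ℤ)] then (1 : ℝ) else 0) :
      ∑ y ∈ range (p ^ γ), g y * F y ≤ p ^ γ * (1 / (1 - δ) * ((p : ℝ)⁻¹) ^ u) := by
    calc ∑ y ∈ range (p ^ γ), g y * F y
        ≤ ∑ y ∈ range (p ^ γ), 1 / (1 - δ) *
            (if (y : ℤ) ≡ r [ZMOD ((p ^ u : ℕ) : ℤ)] then (1 : ℝ) else 0) := by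
          refine Finset.sum_le_sum fun y _ => ?_
          refine (mul_le_mul_of_nonneg_left (hF y) (hg0 y)).trans ?_
          exact mul_le_mul_of_nonneg_right (hg y) (by split_ifs <;> norm_num)
      _ = _ := by
          rw [← Finset.mul_sum, sum_range_prime_pow_modEq hp hu]
          ring
  rw [hc]
  rcases le_total s t with hst | hst
  · rw [max_eq_right hst]
    exact key ht r' _ fun y => by split_ifs <;> norm_num
  · rw [max_eq_left hst]
    exact key hs r _ fun y => by split_ifs <;> norm_num

theorem fibre_moment_le {δ : ℝ} (h1 : δ < 1) {p : ℕ} (hp : 0 < p) (M γ : ℕ) {g : ℕ → ℝ}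
    (hg0 : ∀ y, 0 ≤ g y) (hg : ∀ y, g y ≤ 1 / (1 - δ))
    (hsum : ∑ y ∈ range (p ^ γ), g y = p ^ γ) (b b' : ℕ → ℤ) (x : ℕ) :
    ∑ y ∈ range (p ^ γ), g y *
      ((∑ s ∈ range (γ + 1), ∑ d ∈ M.divisors,
        (if (x : ℤ) ≡ b (p ^ s * d) [ZMOD (d : ℤ)] then (1 : ℝ) else 0) *
        (if (y : ℤ) ≡ b (p ^ s * d) [ZMOD ((p ^ s : ℕ) : ℤ)] then 1 else 0)) *
      (∑ t ∈ range (γ + 1), ∑ e ∈ M.divisors,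
        (if (x : ℤ) ≡ b' (p ^ t * e) [ZMOD (e : ℤ)] then (1 : ℝ) else 0) *
        (if (y : ℤ) ≡ b' (p ^ t * e) [ZMOD ((p ^ t : ℕ) : ℤ)] then 1 else 0))) ≤
      p ^ γ * ∑ s ∈ range (γ + 1), ∑ t ∈ range (γ + 1), momentCoeff δ p s t *
        (hitCount M (fun d => b (p ^ s * d)) x * hitCount M (fun d => b' (p ^ t * d)) x) := by
  simp_rw [hitCount, Finset.sum_mul_sum, Finset.mul_sum]
  rw [Finset.sum_comm]
  refine Finset.sum_le_sum fun s hs => ?_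
  rw [Finset.sum_comm]
  refine Finset.sum_le_sum fun t ht => ?_
  rw [Finset.sum_comm]
  refine Finset.sum_le_sum fun d _ => ?_
  rw [Finset.sum_comm]
  refine Finset.sum_le_sum fun e _ => ?_
  have h := sum_mul_modEq_le_momentCoeff h1 hp (Nat.lt_succ_iff.1 (mem_range.1 hs))
    (Nat.lt_succ_iff.1 (mem_range.1 ht)) hg0 hg hsum (b (p ^ s * d)) (b' (p ^ t * e))
  have hA : (0 : ℝ) ≤ (if (x : ℤ) ≡ b (p ^ s * d) [ZMOD (d : ℤ)] then (1 : ℝ) else 0) *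
      (if (x : ℤ) ≡ b' (p ^ t * e) [ZMOD (e : ℤ)] then (1 : ℝ) else 0) := by
    split_ifs <;> norm_num
  have h' := mul_le_mul_of_nonneg_left h hA
  rw [Finset.mul_sum] at h'
  convert h' using 1
  · refine Finset.sum_congr rfl fun y _ => ?_
    ring
  · ring

theorem IsSieveWeight.exists_prime_pow_mul {a : ℕ → ℤ} {M : ℕ} {w : ℕ → ℝ} {β D : ℝ}
    (h : IsSieveWeight a M w β D) (hM : 0 < M) {p : ℕ} (hp : p.Prime) (hpM : ¬ p ∣ M) (γ : ℕ)
    {δ : ℝ} (h0 : 0 < δ) (h1 : δ < 1) :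
    ∃ w', IsSieveWeight a (p ^ γ * M) w' (β + D / ((p : ℝ) - 1) ^ 2 / (4 * δ * (1 - δ)))
      (D * (1 + (3 * (p : ℝ) - 1) / ((p : ℝ) - 1) ^ 2 / (1 - δ))) := by
  classical
  have hq : 0 < p ^ γ := pow_pos hp.pos γ
  have hq' : (0 : ℝ) < (p : ℝ) ^ γ := by exact_mod_cast hq
  have hc : M.Coprime (p ^ γ) := (((Nat.Prime.coprime_iff_not_dvd hp).2 hpM).pow_left γ).symm
  have hd : 0 < 1 - δ := by linarith
  choose f hf0 hf1 hfsum hfB using fun x =>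
    exists_redistribution (Y := range (p ^ γ)) (B := fibreHits a p γ M x)
      (nonempty_range_iff.2 hq.ne') (filter_subset _ _) h0 h1
  simp only [card_range, Nat.cast_pow] at hfsum hfB
  have hw0 (x y : ℕ) : 0 ≤ w x * (f x y / p ^ γ) :=
    mul_nonneg (h.nonneg x) (div_nonneg (hf0 x y) hq'.le)
  have hsum1 (x : ℕ) : ∑ y ∈ range (p ^ γ), w x * (f x y / p ^ γ) = w x := by
    rw [← Finset.mul_sum, ← Finset.sum_div, hfsum, div_self hq'.ne', mul_one]
  refine ⟨fun z => w (z % M) * (f (z % M) (z % p ^ γ) / p ^ γ), fun z => hw0 _ _, ?_, ?_, ?_⟩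
  · rw [sum_range_mul_of_coprime hM hq hc (fun x y => w x * (f x y / p ^ γ))]
    simp_rw [hsum1]
    exact h.total
  · calc ∑ z ∈ range (p ^ γ * M), (if Covered a (p ^ γ * M) z then
          w (z % M) * (f (z % M) (z % p ^ γ) / p ^ γ) else 0)
        ≤ ∑ z ∈ range (p ^ γ * M), ((fun x y : ℕ =>
          (if Covered a M x then w x * (f x y / p ^ γ) else 0) +
          (if y ∈ fibreHits a p γ M x then w x * (f x y / p ^ γ) else 0))
            (z % M) (z % p ^ γ)) := by
          refine Finset.sum_le_sum fun z _ => ?_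
          have := hw0 (z % M) (z % p ^ γ)
          by_cases hz : Covered a (p ^ γ * M) z
          · rcases covered_prime_pow_mul hp hpM hz with h' | h'
            · simp only [if_pos hz, if_pos h']
              split_ifs <;> linarith
            · simp only [if_pos hz, if_pos h']
              split_ifs <;> linarith
          · simp only [if_neg hz]
            split_ifs <;> linarith
      _ = ∑ x ∈ range M, (if Covered a M x then w x else 0) +
          ∑ x ∈ range M, w x * ((∑ y ∈ fibreHits a p γ M x, f x y) / p ^ γ) := by
          rw [sum_range_mul_of_coprime hM hq hc (fun x y : ℕ =>
            (if Covered a M x then w x * (f x y / p ^ γ) else 0) +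
            (if y ∈ fibreHits a p γ M x then w x * (f x y / p ^ γ) else 0)),
            ← Finset.sum_add_distrib]
          refine Finset.sum_congr rfl fun x _ => ?_
          rw [Finset.sum_add_distrib]
          congr 1
          · split_ifs
            · exact hsum1 x
            · simp
          · rw [← Finset.sum_filter, Finset.sum_div, Finset.mul_sum,
              Finset.filter_mem_eq_inter, Finset.inter_eq_right.2 (show fibreHits a p γ M x ⊆ _ from filter_subset _ _)]
      _ ≤ β + ∑ x ∈ range M, w x * ((#(fibreHits a p γ M x) : ℝ) / p ^ γ) ^ 2 /
            (4 * δ * (1 - δ)) := by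
          refine add_le_add h.covered (Finset.sum_le_sum fun x _ => ?_)
          rw [mul_div_assoc]
          refine mul_le_mul_of_nonneg_left ?_ (h.nonneg x)
          refine (div_le_div_of_nonneg_right (hfB x) hq'.le).trans (le_of_eq ?_)
          field_simp
      _ ≤ _ := by
          rw [← Finset.sum_div]
          have := h.sum_sq_card_fibreHits_le hp γ
          gcongr
  · intro b b'
    simp_rw [hitCount_prime_pow_mul hp hpM]
    rw [sum_range_mul_of_coprime hM hq hc (fun x y => w x * (f x y / p ^ γ) *
      ((∑ s ∈ range (γ + 1), ∑ d ∈ M.divisors,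
        (if (x : ℤ) ≡ b (p ^ s * d) [ZMOD (d : ℤ)] then (1 : ℝ) else 0) *
        (if (y : ℤ) ≡ b (p ^ s * d) [ZMOD ((p ^ s : ℕ) : ℤ)] then 1 else 0)) *
      (∑ t ∈ range (γ + 1), ∑ e ∈ M.divisors,
        (if (x : ℤ) ≡ b' (p ^ t * e) [ZMOD (e : ℤ)] then (1 : ℝ) else 0) *
        (if (y : ℤ) ≡ b' (p ^ t * e) [ZMOD ((p ^ t : ℕ) : ℤ)] then 1 else 0))))]
    calc _ ≤ ∑ x ∈ range M, w x * ∑ s ∈ range (γ + 1), ∑ t ∈ range (γ + 1),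
            momentCoeff δ p s t * (hitCount M (fun d => b (p ^ s * d)) x *
              hitCount M (fun d => b' (p ^ t * d)) x) := by
          refine Finset.sum_le_sum fun x _ => ?_
          have hx := mul_le_mul_of_nonneg_left
            (fibre_moment_le h1 hp.pos M γ (hf0 x) (hf1 x) (hfsum x) b b' x)
            (div_nonneg (h.nonneg x) hq'.le)
          rw [Finset.mul_sum, ← mul_assoc, div_mul_cancel₀ _ hq'.ne'] at hx
          refine le_trans (le_of_eq ?_) hx
          refine Finset.sum_congr rfl fun y _ => ?_
          ring
      _ = ∑ s ∈ range (γ + 1), ∑ t ∈ range (γ + 1), momentCoeff δ p s t *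
            ∑ x ∈ range M, w x * (hitCount M (fun d => b (p ^ s * d)) x *
              hitCount M (fun d => b' (p ^ t * d)) x) := by
          simp_rw [Finset.mul_sum]
          rw [Finset.sum_comm]
          refine Finset.sum_congr rfl fun s _ => ?_
          rw [Finset.sum_comm]
          refine Finset.sum_congr rfl fun t _ => Finset.sum_congr rfl fun x _ => ?_
          ring
      _ ≤ ∑ s ∈ range (γ + 1), ∑ t ∈ range (γ + 1), momentCoeff δ p s t * D := by
          refine Finset.sum_le_sum fun s _ => Finset.sum_le_sum fun t _ =>
            mul_le_mul_of_nonneg_left (h.moment _ _) ?_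
          by_cases hst : s = 0 ∧ t = 0
          · simp [momentCoeff, hst.1, hst.2]
          · have : momentCoeff δ p s t = (1 - δ)⁻¹ * ((p : ℝ)⁻¹) ^ max s t := by
              rw [momentCoeff, sub_eq_self]
              split_ifs <;> simp_all
            rw [this]
            positivity
      _ ≤ _ := by
          simp_rw [← Finset.sum_mul]
          rw [mul_comm]
          exact mul_le_mul_of_nonneg_left (sum_momentCoeff_le h1 hp.one_lt γ) h.moment_nonneg

/-- The number of positive integers below `n` that are coprime to `30`. -/
def count30 (n : ℕ) : ℕ :=
  (n + 28) / 30 + (n + 22) / 30 + (n + 18) / 30 + (n + 16) / 30 + (n + 12) / 30 + (n + 10) / 30 +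
    (n + 6) / 30 + n / 30

theorem count30_le_succ (n : ℕ) : count30 n ≤ count30 (n + 1) := by
  unfold count30
  gcongr <;> omega

theorem count30_prime {p : ℕ} (hp : p.Prime) (h : 19 < p) :
    count30 (p + 1) = count30 p + 1 ∧ 15 * count30 p + 1 ≤ 4 * p := by
  have h2 : p % 2 ≠ 0 := fun h2 => by
    have := (Nat.prime_dvd_prime_iff_eq Nat.prime_two hp).1 (Nat.dvd_of_mod_eq_zero h2); omega
  have h3 : p % 3 ≠ 0 := fun h3 => by
    have := (Nat.prime_dvd_prime_iff_eq Nat.prime_three hp).1 (Nat.dvd_of_mod_eq_zero h3); omega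
  have h5 : p % 5 ≠ 0 := fun h5 => by
    have := (Nat.prime_dvd_prime_iff_eq Nat.prime_five hp).1 (Nat.dvd_of_mod_eq_zero h5); omega
  obtain ⟨k, r, hr, rfl⟩ : ∃ k r, r < 30 ∧ p = 30 * k + r :=
    ⟨p / 30, p % 30, Nat.mod_lt _ (by norm_num), (Nat.div_add_mod p 30).symm⟩
  have hk (c : ℕ) : (30 * k + c) / 30 = k + c / 30 := by omega
  have hr2 : r % 2 ≠ 0 := by omega
  have hr3 : r % 3 ≠ 0 := by omega
  have hr5 : r % 5 ≠ 0 := by omega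
  clear hp h2 h3 h5
  simp only [count30, add_assoc, hk]
  interval_cases r <;> first | contradiction | (norm_num; omega)

theorem potential_step {p u : ℝ} (hp : 23 ≤ p) (hu0 : 1 ≤ u) (hu : 15 * u + 1 ≤ 4 * p) :
    1 / (p - 1) ^ 2 / (4 * (1 / 10) * (1 - 1 / 10)) +
      (1 + (3 * p - 1) / (p - 1) ^ 2 / (1 - 1 / 10)) * (5 / (u + 1)) ≤ 5 / u := by
  have hp1 : 0 < p - 1 := by linarith
  have hu1 : 0 < u := by linarith
  have key : (3 * p - 1) / (9 / 10) * 5 * u + u * (u + 1) / (9 / 25) ≤ 5 * (p - 1) ^ 2 := by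
    nlinarith
  have e : 5 / u - (1 / (p - 1) ^ 2 / (4 * (1 / 10) * (1 - 1 / 10)) +
      (1 + (3 * p - 1) / (p - 1) ^ 2 / (1 - 1 / 10)) * (5 / (u + 1))) =
      (5 * (p - 1) ^ 2 - ((3 * p - 1) / (9 / 10) * 5 * u + u * (u + 1) / (9 / 25))) /
        ((p - 1) ^ 2 * u * (u + 1)) := by
    field_simp
    ring
  have : 0 ≤ 5 / u - (1 / (p - 1) ^ 2 / (4 * (1 / 10) * (1 - 1 / 10)) +
      (1 + (3 * p - 1) / (p - 1) ^ 2 / (1 - 1 / 10)) * (5 / (u + 1))) := by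
    rw [e]
    exact div_nonneg (by linarith) (by positivity)
  linarith

theorem exists_isSieveWeight (a : ℕ → ℤ) {n : ℕ} (hn : 20 ≤ n) :
    ∀ M : ℕ, 0 < M → (∀ p : ℕ, p.Prime → p ∣ M → 19 < p ∧ p < n) →
      ∃ w β D, IsSieveWeight a M w β D ∧ β + D * (5 / count30 n) ≤ 5 / 6 := by
  induction n, hn using Nat.le_induction with
  | base =>
    intro M hM hMp
    have : M = 1 := by
      by_contra hne
      obtain ⟨p, hp, hpM⟩ := Nat.exists_prime_and_dvd hne
      have := hMp p hp hpM
      omega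
    subst this
    exact ⟨_, _, _, isSieveWeight_one a, by norm_num [count30]⟩
  | succ n hn ih =>
    intro M hM hMp
    have hpos : 0 < count30 n := by unfold count30; omega
    by_cases hnp : n.Prime
    · obtain ⟨γ, M', hM', rfl⟩ := Nat.exists_eq_pow_mul_and_not_dvd hM.ne' n hnp.ne_one
      have hM'0 : 0 < M' := Nat.pos_of_mul_pos_left hM
      obtain ⟨w, β, D, hw, hb⟩ := ih M' hM'0 fun p hp hpM => by
        have h1 := hMp p hp (hpM.mul_left _)
        have h2 : p ≠ n := by rintro rfl; exact hM' hpM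
        omega
      obtain ⟨w', hw'⟩ := hw.exists_prime_pow_mul hM'0 hnp hM' γ (δ := 1 / 10)
        (by norm_num) (by norm_num)
      refine ⟨w', _, _, hw', le_trans ?_ hb⟩
      obtain ⟨hc1, hc2⟩ := count30_prime hnp (by omega)
      have hn23 : 23 ≤ n := by
        by_contra hlt
        push Not at hlt
        interval_cases n <;> revert hnp <;> norm_num
      have hstep := mul_le_mul_of_nonneg_left (potential_step (p := n) (u := count30 n)
        (by exact_mod_cast hn23) (by exact_mod_cast hpos) (by exact_mod_cast hc2))
        hw.moment_nonneg
      rw [hc1, Nat.cast_add_one]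
      refine le_trans (le_of_eq ?_) (add_le_add_right hstep β)
      ring
    · obtain ⟨w, β, D, hw, hb⟩ := ih M hM fun p hp hpM => by
        have h1 := hMp p hp hpM
        have h2 : p ≠ n := by rintro rfl; exact hnp hp
        omega
      refine ⟨w, β, D, hw, le_trans ?_ hb⟩
      have := hw.moment_nonneg
      have := count30_le_succ n
      gcongr

/-- **Theorem (main).** Let `q₀ ≥ 19` be a real number. There is no covering system of
the integers all of whose moduli have every prime factor greater than `q₀`:
if `S` is a finite set of integers, each greater than `1`, such that every prime `p`
dividing some `m ∈ S` satisfies `p > q₀`, then for every choice of residues `a`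
the union of the classes `a m mod m` (for `m ∈ S`) is not all of `ℤ`. -/
theorem no_covering_with_all_prime_factors_gt
    (q₀ : ℝ) (hq₀ : 19 ≤ q₀)
    (S : Finset ℕ) (hS : ∀ m ∈ S, 1 < m)
    (hprime : ∀ m ∈ S, ∀ p : ℕ, p.Prime → p ∣ m → q₀ < (p : ℝ))
    (a : ℕ → ℤ) :
    ¬ (∀ n : ℤ, ∃ m ∈ S, n ≡ a m [ZMOD (m : ℤ)]) := by
  intro hcov
  have hM : 0 < ∏ m ∈ S, m := Finset.prod_pos fun m hm => by have := hS m hm; omega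
  obtain ⟨w, β, D, hw, hb⟩ := exists_isSieveWeight a (n := ∏ m ∈ S, m + 20) (by omega)
    (∏ m ∈ S, m) hM fun p hp hpM => by
      obtain ⟨m, hm, hpm⟩ := (hp.prime.dvd_finsetProd_iff _).1 hpM
      refine ⟨?_, ?_⟩
      · exact_mod_cast hq₀.trans_lt (hprime m hm p hp hpm)
      · have := Nat.le_of_dvd hM hpM
        omega
  have hall (x : ℕ) : Covered a (∏ m ∈ S, m) x := by
    obtain ⟨m, hm, hx⟩ := hcov x
    exact ⟨m, Nat.mem_divisors.2 ⟨Finset.dvd_prod_of_mem _ hm, hM.ne'⟩, hS m hm, hx⟩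
  have h1 := hw.covered
  simp only [hall, if_true, hw.total] at h1
  have h2 : 0 ≤ D * (5 / (count30 (∏ m ∈ S, m + 20) : ℝ)) :=
    mul_nonneg hw.moment_nonneg (by positivity)
  linarith
end

section
/- Every covering system of the integers has a modulus divisible by some prime p ≤ 19. That is, if S is a finite set of integers greater than 1 and a : S → ℤ is a choice of residues such that the union of the residue classes a_m mod m over m ∈ S is all of ℤ, then there exists m ∈ S and a prime p ≤ 19 with p ∣ m. -/
open Finset

/-- The indicator function of the residue class of `b` modulo `m`. -/
noncomputable def classInd {R : Type*} [CommRing R] (m : ℕ) (b x : R) : ℝ :=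
  open Classical in if (m : R) ∣ x - b then 1 else 0

/-- The number of divisors `m` of `Q` such that `x` lies in the class of `b m` modulo `m`. -/
noncomputable def classCount {R : Type*} [CommRing R] (Q : ℕ) (b : ℕ → R) (x : R) : ℝ :=
  ∑ m ∈ Q.divisors, classInd m (b m) x

/-- The average of `h` over the points `x + k * Q` with `k < q`. -/
noncomputable def fiberAvg {R : Type*} [CommRing R] (Q q : ℕ) (h : R → ℝ) (x : R) : ℝ :=
  (∑ k ∈ range q, h (x + k * Q)) / q

/-- The indicator function of the union of the classes `a m` modulo `m`
over the elements `m` of `S` dividing `Q`. -/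
noncomputable def coveredInd {R : Type*} [CommRing R] (S : Finset ℕ) (a : ℕ → R) (Q : ℕ) (x : R) :
    ℝ :=
  open Classical in if ∃ m ∈ S, m ∣ Q ∧ (m : R) ∣ x - a m then 1 else 0

/-- There is a `Q`-periodic probability density on `R` giving mass at most `ε` to the
union of the classes whose modulus divides `Q`, and for which the pair correlations of systems of
classes with moduli dividing `Q` are at most `M`. -/
def HasDistortedDensity {R : Type*} [CommRing R] [Fintype R] (S : Finset ℕ) (a : ℕ → R)
    (Q : ℕ) (M ε : ℝ) : Prop :=
  ∃ f : R → ℝ, (∀ x, 0 ≤ f x) ∧ ∑ x, f x = 1 ∧ (∀ x, f (x + Q) = f x) ∧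
    (∀ b b' : ℕ → R, ∑ x, f x * (classCount Q b x * classCount Q b' x) ≤ M) ∧
    ∑ x, f x * coveredInd S a Q x ≤ ε

section Ring

variable {R : Type*} [CommRing R]

lemma classInd_nonneg (m : ℕ) (b x : R) : 0 ≤ classInd m b x := by
  unfold classInd; split_ifs <;> norm_num

lemma classInd_le_one (m : ℕ) (b x : R) : classInd m b x ≤ 1 := by
  unfold classInd; split_ifs <;> norm_num

lemma classCount_nonneg (Q : ℕ) (b : ℕ → R) (x : R) : 0 ≤ classCount Q b x :=
  sum_nonneg fun _ _ => classInd_nonneg _ _ _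

lemma coveredInd_nonneg (S : Finset ℕ) (a : ℕ → R) (Q : ℕ) (x : R) : 0 ≤ coveredInd S a Q x := by
  unfold coveredInd; split_ifs <;> norm_num

lemma classInd_mul_le (m n : ℕ) (b x : R) :
    classInd (m * n) b x ≤ classInd m b x * classInd n b x := by
  unfold classInd
  by_cases h : ((m * n : ℕ) : R) ∣ x - b
  · have h' : (m : R) * n ∣ x - b := by exact_mod_cast h
    rw [if_pos h, if_pos (dvd_of_mul_right_dvd h'), if_pos (dvd_of_mul_left_dvd h'), one_mul]
  · rw [if_neg h]
    split_ifs <;> norm_num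

lemma classInd_add_of_dvd {m Q : ℕ} (h : m ∣ Q) (b x : R) :
    classInd m b (x + Q) = classInd m b x := by
  have h' : (m : R) ∣ (Q : R) := Nat.cast_dvd_cast h
  unfold classInd
  rw [show x + (Q : R) - b = x - b + Q by ring, dvd_add_left h']

lemma classCount_add (Q : ℕ) (b : ℕ → R) (x : R) :
    classCount Q b (x + Q) = classCount Q b x :=
  sum_congr rfl fun _ hm => classInd_add_of_dvd (Nat.dvd_of_mem_divisors hm) _ _

lemma coveredInd_add {Q Q' : ℕ} (hQ : Q ∣ Q') (S : Finset ℕ) (a : ℕ → R) (x : R) :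
    coveredInd S a Q (x + Q') = coveredInd S a Q x := by
  unfold coveredInd
  congr 1
  refine propext (exists_congr fun m => and_congr_right fun _ => and_congr_right fun hm => ?_)
  have h' : (m : R) ∣ (Q' : R) := Nat.cast_dvd_cast (hm.trans hQ)
  rw [show x + (Q' : R) - a m = x - a m + Q' by ring, dvd_add_left h']

lemma periodic_natCast_mul {α : Type*} {f : R → α} {Q : ℕ} (hf : ∀ x, f (x + Q) = f x)
    (k : ℕ) (x : R) : f (x + k * Q) = f x := by
  induction k with
  | zero => simp
  | succ k ih => rw [← ih, ← hf (x + k * Q)]; congr 1; push_cast; ring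

lemma fiberAvg_add {Q q : ℕ} {h : R → ℝ} (hh : ∀ x, h (x + (Q * q : ℕ)) = h x) (x : R) :
    fiberAvg Q q h (x + Q) = fiberAvg Q q h x := by
  unfold fiberAvg
  congr 1
  have h1 := sum_range_succ (fun k : ℕ => h (x + k * Q)) q
  have h2 := sum_range_succ' (fun k : ℕ => h (x + k * Q)) q
  have h3 : h (x + (q : R) * Q) = h x := by rw [← hh x]; push_cast; ring_nf
  have h4 : ∑ k ∈ range q, h (x + Q + k * Q) = ∑ k ∈ range q, h (x + (k + 1 : ℕ) * Q) :=
    sum_congr rfl fun k _ => by congr 1; push_cast; ring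
  rw [h3] at h1
  simp only [Nat.cast_zero, zero_mul, add_zero] at h2
  rw [h4]
  linarith

lemma fiberAvg_mul_left {Q : ℕ} (q : ℕ) {g : R → ℝ} (hg : ∀ x, g (x + Q) = g x) (h : R → ℝ)
    (x : R) : fiberAvg Q q (fun y => g y * h y) x = g x * fiberAvg Q q h x := by
  unfold fiberAvg
  simp only [periodic_natCast_mul hg, ← mul_sum, mul_div_assoc]

lemma fiberAvg_mono (Q q : ℕ) {g h : R → ℝ} (hgh : ∀ x, g x ≤ h x) (x : R) :
    fiberAvg Q q g x ≤ fiberAvg Q q h x := by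
  unfold fiberAvg
  gcongr
  exact hgh _

lemma fiberAvg_sum {ι : Type*} (Q q : ℕ) (s : Finset ι) (h : ι → R → ℝ) (x : R) :
    fiberAvg Q q (fun y => ∑ i ∈ s, h i y) x = ∑ i ∈ s, fiberAvg Q q (h i) x := by
  unfold fiberAvg
  rw [sum_comm, sum_div]

lemma sum_mul_fiberAvg [Fintype R] {Q q : ℕ} (hq : q ≠ 0) {f : R → ℝ}
    (hf : ∀ x, f (x + Q) = f x) (h : R → ℝ) :
    ∑ x, f x * fiberAvg Q q h x = ∑ x, f x * h x := by
  have hk (k : ℕ) : ∑ x, f x * h (x + k * Q) = ∑ x, f x * h x := by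
    rw [← Equiv.sum_comp (Equiv.addRight ((k : R) * Q)) fun x => f x * h x]
    simp [periodic_natCast_mul hf]
  have hq' : (q : ℝ) ≠ 0 := by exact_mod_cast hq
  simp only [fiberAvg, mul_div_assoc', mul_sum]
  rw [← sum_div, sum_comm, sum_congr rfl fun k _ => hk k]
  simp only [sum_const, card_range, nsmul_eq_mul]
  field_simp

/-- Reweighting on each fiber so as to reduce the mass of `B`,
by a factor which is at most `1 / (1 - δ)` everywhere. -/
lemma exists_fiber_weight {Q q : ℕ} (hq : q ≠ 0) {δ : ℝ} (hδ0 : 0 < δ) (hδ1 : δ < 1)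
    (B : R → Prop) [DecidablePred B] (hB : ∀ x, B (x + (Q * q : ℕ)) ↔ B x) :
    ∃ w : R → ℝ, (∀ x, 0 ≤ w x) ∧ (∀ x, w x ≤ 1 / (1 - δ)) ∧
      (∀ x, w (x + (Q * q : ℕ)) = w x) ∧ (∀ x, fiberAvg Q q w x = 1) ∧
      ∀ x, fiberAvg Q q (fun y => w y * if B y then 1 else 0) x ≤
        fiberAvg Q q (fun y => if B y then 1 else 0) x ^ 2 / (4 * δ * (1 - δ)) := by
  set α : R → ℝ := fiberAvg Q q (fun y => if B y then 1 else 0) with hα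
  have hq' : (0 : ℝ) < q := by exact_mod_cast Nat.pos_of_ne_zero hq
  have hαper (x : R) : α (x + Q) = α x := fiberAvg_add (fun y => by simp only [hB]) x
  have hαper' (x : R) : α (x + (Q * q : ℕ)) = α x := by
    rw [← periodic_natCast_mul hαper q x]; push_cast; ring_nf
  have hα0 (x : R) : 0 ≤ α x := by
    simp only [hα, fiberAvg]
    positivity
  set u : R → ℝ := fun x => if α x < δ then 0 else (α x - δ) / (α x * (1 - δ)) with hu
  set v : R → ℝ := fun x => if α x < δ then 1 / (1 - α x) else 1 / (1 - δ) with hv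
  have huper (x : R) : u (x + Q) = u x := by simp only [hu, hαper]
  have hvper (x : R) : v (x + Q) = v x := by simp only [hv, hαper]
  have hδ : 0 < 1 - δ := by linarith
  have havg1 (x : R) : fiberAvg Q q (fun _ => (1 : ℝ)) x = 1 := by
    simp [fiberAvg, hq'.ne']
  have havgB (x : R) : fiberAvg Q q (fun y => u y * if B y then 1 else 0) x = u x * α x :=
    fiberAvg_mul_left q huper _ x
  have havgB' (x : R) :
      fiberAvg Q q (fun y => v y * if B y then 0 else 1) x = v x * (1 - α x) := by
    have h1 : fiberAvg Q q (fun y => if B y then 0 else 1) x + α x =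
        fiberAvg Q q (fun _ => (1 : ℝ)) x := by
      simp only [hα, fiberAvg]
      rw [← add_div, ← sum_add_distrib]
      congr 1
      refine sum_congr rfl fun k _ => ?_
      split_ifs <;> norm_num
    rw [fiberAvg_mul_left q hvper, eq_sub_of_add_eq (h1.trans (havg1 x))]
  refine ⟨fun x => if B x then u x else v x, fun x => ?_, fun x => ?_, fun x => ?_,
    fun x => ?_, fun x => ?_⟩
  · have h1 : 0 ≤ u x := by
      simp only [hu]
      split_ifs with h
      · rfl
      · exact div_nonneg (by linarith) (mul_nonneg (hα0 x) hδ.le)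
    have h2 : 0 ≤ v x := by
      simp only [hv]
      split_ifs with h
      · exact div_nonneg zero_le_one (by linarith)
      · exact div_nonneg zero_le_one hδ.le
    dsimp only
    split_ifs <;> assumption
  · have h1 : u x ≤ 1 / (1 - δ) := by
      simp only [hu]
      split_ifs with h
      · positivity
      · have : 0 < α x := by linarith
        rw [div_le_div_iff₀ (by positivity) hδ]
        nlinarith
    have h2 : v x ≤ 1 / (1 - δ) := by
      simp only [hv]
      split_ifs with h
      · exact one_div_le_one_div_of_le hδ (by linarith)
      · rfl
    dsimp only
    split_ifs <;> assumption
  · simp only [hu, hv, hB, hαper']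
  · have h1 : fiberAvg Q q (fun x => if B x then u x else v x) x = u x * α x + v x * (1 - α x) := by
      rw [← havgB, ← havgB']
      simp only [fiberAvg]
      rw [← add_div, ← sum_add_distrib]
      congr 1
      refine sum_congr rfl fun k _ => ?_
      split_ifs <;> simp
    rw [h1]
    simp only [hu, hv]
    split_ifs with h
    · have : 0 < 1 - α x := by linarith
      field_simp
      ring
    · have : 0 < α x := by linarith
      field_simp
      ring
  · have h1 : fiberAvg Q q (fun y => (if B y then u y else v y) * if B y then 1 else 0) x =
        u x * α x := by
      rw [← havgB]
      simp only [fiberAvg]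
      congr 1
      refine sum_congr rfl fun k _ => ?_
      split_ifs <;> simp
    rw [h1]
    simp only [hu]
    split_ifs with h
    · rw [zero_mul]; positivity
    · have : 0 < α x := by linarith
      rw [le_div_iff₀ (by positivity)]
      field_simp
      nlinarith [sq_nonneg (α x - 2 * δ)]

end Ring

lemma ZMod.int_dvd_of_natCast_dvd_intCast {L d : ℕ} (hd : d ∣ L) {z : ℤ}
    (h : (d : ZMod L) ∣ (z : ZMod L)) : (d : ℤ) ∣ z := by
  obtain ⟨c, hc⟩ := h
  obtain ⟨c, rfl⟩ := ZMod.intCast_surjective c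
  have h1 : ((d * c : ℤ) : ZMod L) = (z : ZMod L) := by rw [hc]; push_cast; rfl
  rw [ZMod.intCast_eq_intCast_iff_dvd_sub] at h1
  have h2 : (d : ℤ) ∣ z - d * c := (Int.natCast_dvd_natCast.mpr hd).trans h1
  exact (dvd_sub_left (dvd_mul_right _ _)).mp h2

lemma fiberAvg_classInd_le {L Q q d : ℕ} (hq : q ≠ 0) (hdL : d ∣ L) (hdq : d ∣ q)
    (hQ : Q.Coprime d) (b x : ZMod L) : fiberAvg Q q (classInd d b) x ≤ 1 / d := by
  classical
  have hd : d ≠ 0 := fun h => hq (by simpa [h] using hdq)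
  set s := (range q).filter fun k : ℕ => (d : ZMod L) ∣ x + k * Q - b with hs
  have hsum : ∑ k ∈ range q, classInd d b (x + k * Q) = s.card := by
    rw [hs, card_filter]
    push_cast
    refine sum_congr rfl fun k _ => ?_
    unfold classInd
    congr
  have hcard : s.card ≤ q / d := by
    rcases s.eq_empty_or_nonempty with h | ⟨k₀, hk₀⟩
    · simp [h]
    · have hsub : s ⊆ (range q).filter fun k => k ≡ k₀ [MOD d] := by
        intro k hk
        simp only [hs, mem_filter] at hk hk₀ ⊢
        refine ⟨hk.1, ?_⟩
        have h1 := dvd_sub hk₀.2 hk.2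
        rw [show x + (k₀ : ZMod L) * Q - b - (x + k * Q - b) = (((k₀ - k : ℤ) * Q : ℤ) : ZMod L) by
          push_cast; ring] at h1
        have h2 := ZMod.int_dvd_of_natCast_dvd_intCast hdL h1
        have h3 : IsCoprime (d : ℤ) (Q : ℤ) := Nat.isCoprime_iff_coprime.mpr hQ.symm
        exact (Nat.modEq_iff_dvd).mpr (h3.dvd_of_dvd_mul_right h2)
      refine (card_le_card hsub).trans ?_
      rw [← Nat.count_eq_card_filter_range, Nat.count_modEq_card _ (Nat.pos_of_ne_zero hd),
        Nat.mod_eq_zero_of_dvd hdq]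
      simp
  unfold fiberAvg
  rw [hsum]
  have hq' : (0 : ℝ) < q := by exact_mod_cast Nat.pos_of_ne_zero hq
  have hd' : (0 : ℝ) < d := by exact_mod_cast Nat.pos_of_ne_zero hd
  rw [div_le_div_iff₀ hq' hd', one_mul]
  exact_mod_cast (Nat.mul_le_mul_right d hcard).trans (Nat.div_mul_le_self q d)

lemma sum_divisors_mul_prime_pow_le {Q p : ℕ} (hp : p.Prime) (γ : ℕ) {g : ℕ → ℝ}
    (hg : ∀ n, 0 ≤ g n) :
    ∑ n ∈ (Q * p ^ γ).divisors, g n ≤ ∑ j ∈ range (γ + 1), ∑ m ∈ Q.divisors, g (m * p ^ j) := by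
  rw [← sum_product']
  have hsub : (Q * p ^ γ).divisors ⊆
      (range (γ + 1) ×ˢ Q.divisors).image fun i => i.2 * p ^ i.1 := by
    intro n hn
    obtain ⟨hn, h0⟩ := Nat.mem_divisors.mp hn
    obtain ⟨m, k, hm, hk, rfl⟩ := Nat.dvd_mul.mp hn
    obtain ⟨j, hj, rfl⟩ := (Nat.dvd_prime_pow hp).mp hk
    exact mem_image.mpr ⟨(j, m), by
      simp [hm, left_ne_zero_of_mul h0, Nat.lt_succ_of_le hj], rfl⟩
  refine (sum_le_sum_of_subset_of_nonneg hsub fun _ _ _ => hg _).trans ?_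
  exact sum_image_le_of_nonneg fun _ _ => hg _

lemma sum_range_inv_pow_le {r : ℝ} (hr : 1 < r) (γ : ℕ) :
    ∑ j ∈ range γ, 1 / r ^ (j + 1) ≤ 1 / (r - 1) := by
  have h : ∑ j ∈ range γ, 1 / r ^ (j + 1) = (1 - 1 / r ^ γ) / (r - 1) := by
    have h1 : r - 1 ≠ 0 := by linarith
    have h2 : r ≠ 0 := by linarith
    induction γ with
    | zero => simp
    | succ γ ih => rw [sum_range_succ, ih, pow_succ]; field_simp; ring
  rw [h]
  have : 0 < r - 1 := by linarith
  have : 0 ≤ 1 / r ^ γ := by positivity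
  gcongr
  linarith

/-- The pair `(0, 0)` contributes `1`, the other pairs contribute `c / r ^ max i j`. -/
lemma sum_sum_range_inv_pow_max_le {r c : ℝ} (hr : 1 < r) (hc : 0 ≤ c) (γ : ℕ) :
    ∑ i ∈ range (γ + 1), ∑ j ∈ range (γ + 1),
      (if max i j = 0 then 1 else c * (1 / r ^ max i j)) ≤
        1 + c * ((3 * r - 1) / (r - 1) ^ 2) := by
  have h1 : r - 1 ≠ 0 := by linarith
  have h2 : r ≠ 0 := by linarith
  have h : ∑ i ∈ range (γ + 1), ∑ j ∈ range (γ + 1),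
      (if max i j = 0 then 1 else c * (1 / r ^ max i j)) =
        1 + c * ((3 * r - 1) / (r - 1) ^ 2) -
          c * (((2 * γ + 3) * r - (2 * γ + 1)) / (r ^ γ * (r - 1) ^ 2)) := by
    induction γ with
    | zero => simp
    | succ γ ih =>
      rw [sum_range_succ]
      simp_rw [sum_range_succ _ (γ + 1)]
      rw [sum_add_distrib, ih]
      have h3 : ∀ i ∈ range (γ + 1), (if max i (γ + 1) = 0 then (1 : ℝ) else
          c * (1 / r ^ max i (γ + 1))) = c * (1 / r ^ (γ + 1)) := fun i hi => by
        rw [max_eq_right (mem_range.mp hi).le, if_neg (by omega)]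
      have h4 : ∀ i ∈ range (γ + 1), (if max (γ + 1) i = 0 then (1 : ℝ) else
          c * (1 / r ^ max (γ + 1) i)) = c * (1 / r ^ (γ + 1)) := fun i hi => by
        rw [max_eq_left (mem_range.mp hi).le, if_neg (by omega)]
      rw [sum_congr rfl h3, sum_congr rfl h4]
      simp only [max_self, sum_const, card_range, nsmul_eq_mul]
      rw [if_neg (by omega)]
      push_cast
      rw [pow_succ]
      field_simp
      ring
  rw [h]
  have : 0 ≤ c * (((2 * γ + 3) * r - (2 * γ + 1)) / (r ^ γ * (r - 1) ^ 2)) := by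
    refine mul_nonneg hc (div_nonneg ?_ (by positivity))
    nlinarith [(Nat.cast_nonneg γ : (0 : ℝ) ≤ γ)]
  linarith

section Step

variable {L Q p γ : ℕ}

lemma sum_mul_weight_classInd_le [NeZero L] (hp : p.Prime) (hpQ : ¬ p ∣ Q) (hL : Q * p ^ γ ∣ L)
    {f w : ZMod L → ℝ} (hf : ∀ x, 0 ≤ f x) (hfQ : ∀ x, f (x + Q) = f x) {c : ℝ} (hc : 0 ≤ c)
    (hw : ∀ x, w x ≤ c) {m m' i j : ℕ} (hm : m ∣ Q) (hm' : m' ∣ Q)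
    (hi : i ≤ γ) (hj : j ≤ γ) (β β' : ZMod L) :
    ∑ x, f x * w x * ((classInd m β x * classInd (p ^ i) β x) *
      (classInd m' β' x * classInd (p ^ j) β' x)) ≤
        c * (1 / (p : ℝ) ^ max i j) * ∑ x, f x * (classInd m β x * classInd m' β' x) := by
  obtain ⟨b, hb⟩ : ∃ b, ∀ x, classInd (p ^ i) β x * classInd (p ^ j) β' x ≤
      classInd (p ^ max i j) b x := by
    rcases le_total i j with h | h
    · refine ⟨β', fun x => ?_⟩
      rw [max_eq_right h]
      exact mul_le_of_le_one_left (classInd_nonneg _ _ _) (classInd_le_one _ _ _)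
    · refine ⟨β, fun x => ?_⟩
      rw [max_eq_left h]
      exact mul_le_of_le_one_right (classInd_nonneg _ _ _) (classInd_le_one _ _ _)
  set g : ZMod L → ℝ := fun x => f x * (classInd m β x * classInd m' β' x) with hg
  have hg0 (x : ZMod L) : 0 ≤ g x :=
    mul_nonneg (hf x) (mul_nonneg (classInd_nonneg _ _ _) (classInd_nonneg _ _ _))
  have hgQ (x : ZMod L) : g (x + Q) = g x := by
    simp only [hg, hfQ, classInd_add_of_dvd hm, classInd_add_of_dvd hm']
  have hq : p ^ γ ≠ 0 := pow_ne_zero _ hp.ne_zero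
  have hmax : p ^ max i j ∣ p ^ γ := pow_dvd_pow _ (max_le hi hj)
  calc _ = ∑ x, g x * (w x * (classInd (p ^ i) β x * classInd (p ^ j) β' x)) :=
        sum_congr rfl fun x _ => by simp only [hg]; ring
    _ ≤ ∑ x, g x * (c * classInd (p ^ max i j) b x) := by
        refine sum_le_sum fun x _ => mul_le_mul_of_nonneg_left ?_ (hg0 x)
        exact mul_le_mul (hw x) (hb x)
          (mul_nonneg (classInd_nonneg _ _ _) (classInd_nonneg _ _ _)) hc
    _ = c * ∑ x, g x * classInd (p ^ max i j) b x := by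
        rw [mul_sum]; exact sum_congr rfl fun x _ => by ring
    _ = c * ∑ x, g x * fiberAvg Q (p ^ γ) (classInd (p ^ max i j) b) x := by
        rw [sum_mul_fiberAvg hq hgQ]
    _ ≤ c * ∑ x, g x * (1 / (p : ℝ) ^ max i j) := by
        gcongr with x
        · exact hg0 x
        · have h := fiberAvg_classInd_le hq (hmax.trans ((dvd_mul_left _ _).trans hL)) hmax
            (((Nat.Prime.coprime_iff_not_dvd hp).mpr hpQ).symm.pow_right _) b x
          exact_mod_cast h
    _ = _ := by rw [← sum_mul]; ring

lemma classCount_mul_prime_pow_le {R : Type*} [CommRing R] (hp : p.Prime) (b : ℕ → R) (x : R) :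
    classCount (Q * p ^ γ) b x ≤ ∑ j ∈ range (γ + 1), ∑ m ∈ Q.divisors,
      classInd m (b (m * p ^ j)) x * classInd (p ^ j) (b (m * p ^ j)) x :=
  (sum_divisors_mul_prime_pow_le hp γ fun _ => classInd_nonneg _ _ _).trans <|
    sum_le_sum fun _ _ => sum_le_sum fun _ _ => classInd_mul_le _ _ _ _

lemma sum_mul_weight_classCount_le [NeZero L] (hp : p.Prime) (hpQ : ¬ p ∣ Q)
    (hL : Q * p ^ γ ∣ L) {f w : ZMod L → ℝ} (hf : ∀ x, 0 ≤ f x) (hfQ : ∀ x, f (x + Q) = f x)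
    {M : ℝ} (hM : ∀ b b' : ℕ → ZMod L, ∑ x, f x * (classCount Q b x * classCount Q b' x) ≤ M)
    {c : ℝ} (hc : 0 ≤ c) (hw0 : ∀ x, 0 ≤ w x) (hw : ∀ x, w x ≤ c)
    (havg : ∀ x, fiberAvg Q (p ^ γ) w x = 1) (b b' : ℕ → ZMod L) :
    ∑ x, f x * w x * (classCount (Q * p ^ γ) b x * classCount (Q * p ^ γ) b' x) ≤
      M * (1 + c * ((3 * p - 1) / (p - 1) ^ 2)) := by
  have hq : p ^ γ ≠ 0 := pow_ne_zero _ hp.ne_zero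
  have hp1 : (1 : ℝ) < p := by exact_mod_cast hp.one_lt
  have hM0 : 0 ≤ M := le_trans (sum_nonneg fun x _ => mul_nonneg (hf x)
    (mul_nonneg (classCount_nonneg _ _ _) (classCount_nonneg _ _ _))) (hM b b')
  set A : (ℕ → ZMod L) → ℕ → ZMod L → ℝ := fun b j x => ∑ m ∈ Q.divisors,
    classInd m (b (m * p ^ j)) x * classInd (p ^ j) (b (m * p ^ j)) x with hA
  have hA0 (b j x) : 0 ≤ A b j x :=
    sum_nonneg fun _ _ => mul_nonneg (classInd_nonneg _ _ _) (classInd_nonneg _ _ _)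
  have hAle (b j x) : A b j x ≤ classCount Q (fun m => b (m * p ^ j)) x :=
    sum_le_sum fun _ _ => mul_le_of_le_one_right (classInd_nonneg _ _ _) (classInd_le_one _ _ _)
  have key : ∀ i ∈ range (γ + 1), ∀ j ∈ range (γ + 1),
      ∑ x, f x * w x * (A b i x * A b' j x) ≤
        M * (if max i j = 0 then 1 else c * (1 / (p : ℝ) ^ max i j)) := by
    intro i hi j hj
    split_ifs with h
    · set X := classCount Q (fun m => b (m * p ^ i))
      set X' := classCount Q (fun m => b' (m * p ^ j))
      have hper (x : ZMod L) : f (x + Q) * (X (x + Q) * X' (x + Q)) = f x * (X x * X' x) := by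
        simp only [X, X', hfQ, classCount_add]
      calc _ ≤ ∑ x, f x * w x * (X x * X' x) := by
            refine sum_le_sum fun x _ => mul_le_mul_of_nonneg_left ?_ (mul_nonneg (hf x) (hw0 x))
            exact mul_le_mul (hAle _ _ _) (hAle _ _ _) (hA0 _ _ _) (classCount_nonneg _ _ _)
        _ = ∑ x, f x * (X x * X' x) * w x := sum_congr rfl fun x _ => by ring
        _ = ∑ x, f x * (X x * X' x) * fiberAvg Q (p ^ γ) w x :=
            (sum_mul_fiberAvg hq (f := fun x => f x * (X x * X' x)) hper w).symm
        _ = ∑ x, f x * (X x * X' x) := by simp only [havg, mul_one]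
        _ ≤ M * 1 := by rw [mul_one]; exact hM _ _
    · calc _ = ∑ m ∈ Q.divisors, ∑ m' ∈ Q.divisors, ∑ x, f x * w x *
            ((classInd m (b (m * p ^ i)) x * classInd (p ^ i) (b (m * p ^ i)) x) *
              (classInd m' (b' (m' * p ^ j)) x * classInd (p ^ j) (b' (m' * p ^ j)) x)) := by
            simp only [hA, sum_mul_sum]
            simp only [mul_sum]
            rw [sum_comm]
            exact sum_congr rfl fun m _ => sum_comm
        _ ≤ ∑ m ∈ Q.divisors, ∑ m' ∈ Q.divisors, c * (1 / (p : ℝ) ^ max i j) *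
            ∑ x, f x * (classInd m (b (m * p ^ i)) x * classInd m' (b' (m' * p ^ j)) x) :=
            sum_le_sum fun m hm => sum_le_sum fun m' hm' =>
              sum_mul_weight_classInd_le hp hpQ hL hf hfQ hc hw (Nat.dvd_of_mem_divisors hm)
                (Nat.dvd_of_mem_divisors hm') (Nat.lt_succ_iff.mp (mem_range.mp hi))
                (Nat.lt_succ_iff.mp (mem_range.mp hj)) _ _
        _ = c * (1 / (p : ℝ) ^ max i j) * ∑ x, f x * (classCount Q (fun m => b (m * p ^ i)) x *
            classCount Q (fun m => b' (m * p ^ j)) x) := by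
            simp only [classCount, sum_mul_sum, ← mul_sum]
            congr 1
            simp only [mul_sum]
            rw [sum_comm (s := univ)]
            exact sum_congr rfl fun m _ => sum_comm
        _ ≤ c * (1 / (p : ℝ) ^ max i j) * M := by
            gcongr
            exact hM _ _
        _ = _ := mul_comm _ _
  calc _ ≤ ∑ x, f x * w x *
        ((∑ i ∈ range (γ + 1), A b i x) * ∑ j ∈ range (γ + 1), A b' j x) := by
        refine sum_le_sum fun x _ => mul_le_mul_of_nonneg_left ?_ (mul_nonneg (hf x) (hw0 x))
        exact mul_le_mul (classCount_mul_prime_pow_le hp _ _) (classCount_mul_prime_pow_le hp _ _)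
          (classCount_nonneg _ _ _) (sum_nonneg fun _ _ => hA0 _ _ _)
    _ = ∑ i ∈ range (γ + 1), ∑ j ∈ range (γ + 1), ∑ x, f x * w x * (A b i x * A b' j x) := by
        simp only [sum_mul_sum]
        simp only [mul_sum]
        rw [sum_comm]
        exact sum_congr rfl fun m _ => sum_comm
    _ ≤ ∑ i ∈ range (γ + 1), ∑ j ∈ range (γ + 1),
        M * (if max i j = 0 then 1 else c * (1 / (p : ℝ) ^ max i j)) :=
        sum_le_sum fun i hi => sum_le_sum fun j hj => key i hi j hj
    _ = M * ∑ i ∈ range (γ + 1), ∑ j ∈ range (γ + 1),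
        (if max i j = 0 then 1 else c * (1 / (p : ℝ) ^ max i j)) := by simp only [mul_sum]
    _ ≤ _ := mul_le_mul_of_nonneg_left (sum_sum_range_inv_pow_max_le hp1 hc γ) hM0

/-- The second moment bound for the fiber densities of the classes whose modulus divides
`Q * p ^ γ` but not `Q`. -/
lemma sum_mul_sq_fiberAvg_le [NeZero L] (hp : p.Prime) (hpQ : ¬ p ∣ Q) (hL : Q * p ^ γ ∣ L)
    {f : ZMod L → ℝ} (hf : ∀ x, 0 ≤ f x)
    {M : ℝ} (hM : ∀ b b' : ℕ → ZMod L, ∑ x, f x * (classCount Q b x * classCount Q b' x) ≤ M)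
    (a : ℕ → ZMod L) {h : ZMod L → ℝ} (h0 : ∀ x, 0 ≤ h x)
    (hh : ∀ x, h x ≤ ∑ j ∈ range γ, ∑ m ∈ Q.divisors, classInd (m * p ^ (j + 1))
      (a (m * p ^ (j + 1))) x) :
    ∑ x, f x * fiberAvg Q (p ^ γ) h x ^ 2 ≤ M / (p - 1) ^ 2 := by
  have hq : p ^ γ ≠ 0 := pow_ne_zero _ hp.ne_zero
  have hp1 : (1 : ℝ) < p := by exact_mod_cast hp.one_lt
  have hM0 : 0 ≤ M := le_trans (sum_nonneg fun x _ => mul_nonneg (hf x)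
    (mul_nonneg (classCount_nonneg _ _ _) (classCount_nonneg _ _ _))) (hM a a)
  set X : ℕ → ZMod L → ℝ := fun j => classCount Q fun m => a (m * p ^ (j + 1)) with hX
  have havg (x : ZMod L) : fiberAvg Q (p ^ γ) h x ≤
      ∑ j ∈ range γ, 1 / (p : ℝ) ^ (j + 1) * X j x := by
    calc _ ≤ fiberAvg Q (p ^ γ) (fun x => ∑ j ∈ range γ, ∑ m ∈ Q.divisors,
          classInd m (a (m * p ^ (j + 1))) x * classInd (p ^ (j + 1)) (a (m * p ^ (j + 1))) x) x :=
          fiberAvg_mono _ _ (fun x => (hh x).trans <| sum_le_sum fun j _ => sum_le_sum fun m _ =>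
            classInd_mul_le _ _ _ _) x
      _ = ∑ j ∈ range γ, ∑ m ∈ Q.divisors, classInd m (a (m * p ^ (j + 1))) x *
          fiberAvg Q (p ^ γ) (classInd (p ^ (j + 1)) (a (m * p ^ (j + 1)))) x := by
          simp only [fiberAvg_sum]
          exact sum_congr rfl fun j _ => sum_congr rfl fun m hm =>
            fiberAvg_mul_left _ (classInd_add_of_dvd (Nat.dvd_of_mem_divisors hm) _) _ _
      _ ≤ ∑ j ∈ range γ, ∑ m ∈ Q.divisors, classInd m (a (m * p ^ (j + 1))) x *
          (1 / (p : ℝ) ^ (j + 1)) := by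
          refine sum_le_sum fun j hj => sum_le_sum fun m _ =>
            mul_le_mul_of_nonneg_left ?_ (classInd_nonneg _ _ _)
          have hd : p ^ (j + 1) ∣ p ^ γ := pow_dvd_pow _ (mem_range.mp hj)
          have h := fiberAvg_classInd_le hq (hd.trans ((dvd_mul_left _ _).trans hL)) hd
            (((Nat.Prime.coprime_iff_not_dvd hp).mpr hpQ).symm.pow_right _)
            (a (m * p ^ (j + 1))) x
          exact_mod_cast h
      _ = _ := by
          simp only [hX, classCount, mul_sum]
          exact sum_congr rfl fun j _ => sum_congr rfl fun m _ => mul_comm _ _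
  have havg0 (x : ZMod L) : 0 ≤ fiberAvg Q (p ^ γ) h x :=
    div_nonneg (sum_nonneg fun _ _ => h0 _) (Nat.cast_nonneg _)
  calc _ ≤ ∑ x, f x * (∑ j ∈ range γ, 1 / (p : ℝ) ^ (j + 1) * X j x) ^ 2 :=
        sum_le_sum fun x _ => mul_le_mul_of_nonneg_left
          (pow_le_pow_left₀ (havg0 x) (havg x) 2) (hf x)
    _ = ∑ i ∈ range γ, ∑ j ∈ range γ, 1 / (p : ℝ) ^ (i + 1) * (1 / (p : ℝ) ^ (j + 1)) *
        ∑ x, f x * (X i x * X j x) := by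
        simp only [sq, sum_mul_sum]
        simp only [mul_sum]
        rw [sum_comm]
        refine sum_congr rfl fun i _ => sum_comm.trans ?_
        exact sum_congr rfl fun j _ => sum_congr rfl fun x _ => by ring
    _ ≤ ∑ i ∈ range γ, ∑ j ∈ range γ, 1 / (p : ℝ) ^ (i + 1) * (1 / (p : ℝ) ^ (j + 1)) * M := by
        gcongr
        exact hM _ _
    _ = M * (∑ j ∈ range γ, 1 / (p : ℝ) ^ (j + 1)) ^ 2 := by
        simp only [sq, sum_mul_sum]
        simp only [mul_sum]
        exact sum_congr rfl fun i _ => sum_congr rfl fun j _ => by ring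
    _ ≤ M * (1 / (p - 1)) ^ 2 := by
        gcongr
        exact sum_range_inv_pow_le hp1 γ
    _ = _ := by rw [div_pow, one_pow, mul_one_div]

/-- The distortion step at the prime `p`. -/
lemma HasDistortedDensity.mul_prime_pow [NeZero L] {S : Finset ℕ} {a : ℕ → ZMod L} {M ε : ℝ}
    (H : HasDistortedDensity S a Q M ε) (hp : p.Prime) (hpQ : ¬ p ∣ Q) (hL : Q * p ^ γ ∣ L)
    {δ : ℝ} (hδ0 : 0 < δ) (hδ1 : δ < 1) :
    HasDistortedDensity S a (Q * p ^ γ)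
      (M * (1 + 1 / (1 - δ) * ((3 * p - 1) / (p - 1) ^ 2)))
      (ε + M / (p - 1) ^ 2 / (4 * δ * (1 - δ))) := by
  classical
  obtain ⟨f, hf, hf1, hfQ, hM, hε⟩ := H
  have hq : p ^ γ ≠ 0 := pow_ne_zero _ hp.ne_zero
  have hδ : 0 < 1 - δ := by linarith
  set B : ZMod L → Prop := fun x => ∃ m ∈ S, m ∣ Q * p ^ γ ∧ ¬ m ∣ Q ∧ (m : ZMod L) ∣ x - a m
    with hBdef
  have hB (x : ZMod L) : B (x + (Q * p ^ γ : ℕ)) ↔ B x := by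
    simp only [hBdef]
    refine exists_congr fun m => and_congr_right fun _ => and_congr_right fun hm =>
      and_congr_right fun _ => ?_
    have h' : (m : ZMod L) ∣ ((Q * p ^ γ : ℕ) : ZMod L) := Nat.cast_dvd_cast hm
    rw [show x + ((Q * p ^ γ : ℕ) : ZMod L) - a m = x - a m + (Q * p ^ γ : ℕ) by ring,
      dvd_add_left h']
  have hBle (x : ZMod L) : (if B x then (1 : ℝ) else 0) ≤ ∑ j ∈ range γ, ∑ m ∈ Q.divisors,
      classInd (m * p ^ (j + 1)) (a (m * p ^ (j + 1))) x := by
    have hnn (j m : ℕ) : 0 ≤ classInd (m * p ^ (j + 1)) (a (m * p ^ (j + 1))) x :=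
      classInd_nonneg _ _ _
    split_ifs with h
    · obtain ⟨n, -, hn, hnQ, hx⟩ := h
      obtain ⟨m, k, hm, hk, rfl⟩ := Nat.dvd_mul.mp hn
      obtain ⟨j, hj, rfl⟩ := (Nat.dvd_prime_pow hp).mp hk
      obtain ⟨j, rfl⟩ : ∃ i, j = i + 1 :=
        Nat.exists_eq_succ_of_ne_zero fun h0 => hnQ (by simpa [h0] using hm)
      have hQ0 : Q ≠ 0 := fun h0 => hpQ (by simp [h0])
      have h1 : classInd (m * p ^ (j + 1)) (a (m * p ^ (j + 1))) x = 1 := if_pos hx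
      rw [← h1]
      refine (single_le_sum (f := fun m => classInd (m * p ^ (j + 1)) (a (m * p ^ (j + 1))) x)
        (fun m _ => hnn j m) (Nat.mem_divisors.mpr ⟨hm, hQ0⟩)).trans ?_
      exact single_le_sum (f := fun j => ∑ m ∈ Q.divisors,
        classInd (m * p ^ (j + 1)) (a (m * p ^ (j + 1))) x)
        (fun j _ => sum_nonneg fun m _ => hnn j m) (mem_range.mpr hj)
    · exact sum_nonneg fun j _ => sum_nonneg fun m _ => hnn j m
  obtain ⟨w, hw0, hw, hwper, havg, hwB⟩ := exists_fiber_weight hq hδ0 hδ1 B hB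
  have hfQ' (x : ZMod L) : f (x + (Q * p ^ γ : ℕ)) = f x := by
    rw [← periodic_natCast_mul hfQ (p ^ γ) x]; congr 1; push_cast; ring
  refine ⟨fun x => f x * w x, fun x => mul_nonneg (hf x) (hw0 x), ?_, fun x => ?_,
    sum_mul_weight_classCount_le hp hpQ hL hf hfQ hM (by positivity) hw0 hw havg, ?_⟩
  · rw [← sum_mul_fiberAvg hq hfQ, ← hf1]
    simp only [havg, mul_one]
  · simp only [hfQ', hwper]
  · have hcov (x : ZMod L) : coveredInd S a (Q * p ^ γ) x ≤
        coveredInd S a Q x + if B x then 1 else 0 := by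
      have h0 := coveredInd_nonneg S a Q x
      by_cases hx : ∃ m ∈ S, m ∣ Q * p ^ γ ∧ (m : ZMod L) ∣ x - a m
      · have h1 : coveredInd S a (Q * p ^ γ) x = 1 := if_pos hx
        obtain ⟨m, hmS, hm, hmx⟩ := hx
        rw [h1]
        by_cases hmQ : m ∣ Q
        · have h2 : coveredInd S a Q x = 1 := if_pos ⟨m, hmS, hmQ, hmx⟩
          rw [h2]
          split_ifs <;> norm_num
        · rw [if_pos ⟨m, hmS, hm, hmQ, hmx⟩]
          linarith
      · have h1 : coveredInd S a (Q * p ^ γ) x = 0 := if_neg hx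
        rw [h1]
        split_ifs <;> linarith
    have hold : ∑ x, f x * w x * coveredInd S a Q x ≤ ε := by
      have hper (x : ZMod L) :
          f (x + Q) * coveredInd S a Q (x + Q) = f x * coveredInd S a Q x := by
        rw [hfQ, coveredInd_add dvd_rfl]
      have h := sum_mul_fiberAvg hq (f := fun x => f x * coveredInd S a Q x) hper w
      simp only [havg, mul_one] at h
      refine le_trans (le_of_eq ?_) (h ▸ hε)
      exact sum_congr rfl fun x _ => by ring
    have hnew : ∑ x, f x * w x * (if B x then 1 else 0) ≤
        M / (p - 1) ^ 2 / (4 * δ * (1 - δ)) := by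
      calc _ = ∑ x, f x * (w x * if B x then 1 else 0) := by simp only [mul_assoc]
        _ = ∑ x, f x * fiberAvg Q (p ^ γ) (fun y => w y * if B y then 1 else 0) x :=
            (sum_mul_fiberAvg hq hfQ _).symm
        _ ≤ ∑ x, f x * (fiberAvg Q (p ^ γ) (fun y => if B y then 1 else 0) x ^ 2 /
            (4 * δ * (1 - δ))) :=
            sum_le_sum fun x _ => mul_le_mul_of_nonneg_left (hwB x) (hf x)
        _ = (∑ x, f x * fiberAvg Q (p ^ γ) (fun y => if B y then 1 else 0) x ^ 2) /
            (4 * δ * (1 - δ)) := by simp only [sum_div, mul_div_assoc]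
        _ ≤ _ := by
            gcongr
            exact sum_mul_sq_fiberAvg_le hp hpQ hL hf hM a
              (fun x => by split_ifs <;> norm_num) hBle
    calc _ ≤ ∑ x, f x * w x * (coveredInd S a Q x + if B x then 1 else 0) :=
          sum_le_sum fun x _ => mul_le_mul_of_nonneg_left (hcov x) (mul_nonneg (hf x) (hw0 x))
      _ ≤ _ := by
          simp only [mul_add, sum_add_distrib]
          exact add_le_add hold hnew

end Step

lemma hasDistortedDensity_one {L : ℕ} [NeZero L] {S : Finset ℕ} (hS : 1 ∉ S) (a : ℕ → ZMod L) :
    HasDistortedDensity S a 1 1 0 := by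
  have hL : (L : ℝ) ≠ 0 := by exact_mod_cast NeZero.ne L
  refine ⟨fun _ => 1 / L, fun x => by positivity, ?_, fun x => rfl, fun b b' => ?_, ?_⟩
  · simp [hL]
  · have h (b : ℕ → ZMod L) (x : ZMod L) : classCount 1 b x = 1 := by
      simp [classCount, classInd]
    simp [h, hL]
  · have h (x : ZMod L) : coveredInd S a 1 x = 0 := by
      refine if_neg ?_
      rintro ⟨m, hm, h1, -⟩
      exact hS (Nat.dvd_one.mp h1 ▸ hm)
    simp [h]

/-- The number of positive integers below `n` that are coprime to `30`. -/
def countCoprimeThirty (n : ℕ) : ℕ :=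
  (n + 28) / 30 + (n + 22) / 30 + (n + 18) / 30 + (n + 16) / 30 + (n + 12) / 30 +
    (n + 10) / 30 + (n + 6) / 30 + n / 30

lemma countCoprimeThirty_le_succ (n : ℕ) : countCoprimeThirty n ≤ countCoprimeThirty (n + 1) := by
  unfold countCoprimeThirty
  gcongr <;> omega

lemma countCoprimeThirty_of_prime {p : ℕ} (hp : p.Prime) (h : 5 < p) :
    countCoprimeThirty (p + 1) = countCoprimeThirty p + 1 ∧ 30 * countCoprimeThirty p + 2 ≤ 8 * p := by
  have h2 : p % 2 ≠ 0 := fun h0 => by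
    have := (Nat.prime_dvd_prime_iff_eq Nat.prime_two hp).mp (Nat.dvd_of_mod_eq_zero h0)
    omega
  have h3 : p % 3 ≠ 0 := fun h0 => by
    have := (Nat.prime_dvd_prime_iff_eq Nat.prime_three hp).mp (Nat.dvd_of_mod_eq_zero h0)
    omega
  have h5 : p % 5 ≠ 0 := fun h0 => by
    have := (Nat.prime_dvd_prime_iff_eq Nat.prime_five hp).mp (Nat.dvd_of_mod_eq_zero h0)
    omega
  obtain ⟨k, r, hr, rfl⟩ : ∃ k r, r < 30 ∧ p = 30 * k + r :=
    ⟨p / 30, p % 30, Nat.mod_lt _ (by norm_num), (Nat.div_add_mod p 30).symm⟩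
  clear hp h
  unfold countCoprimeThirty
  interval_cases r <;> omega

lemma six_le_countCoprimeThirty {n : ℕ} (hn : 23 ≤ n) : 6 ≤ countCoprimeThirty n := by
  unfold countCoprimeThirty
  omega

lemma distortion_potential_le {p u M : ℝ} (hp : 23 ≤ p) (hu : 4 ≤ u) (hup : 30 * u + 62 ≤ 8 * p)
    (hM : 0 ≤ M) :
    M / (p - 1) ^ 2 / (4 * (1 / 10) * (1 - 1 / 10)) +
      2 / (u + 1) * (M * (1 + 1 / (1 - 1 / 10) * ((3 * p - 1) / (p - 1) ^ 2))) ≤ 2 / u * M := by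
  have h1 : 0 < p - 1 := by linarith
  have h2 : 0 < u := by linarith
  have h3 : 25 / 9 * (u * (u + 1)) + 20 / 9 * (u * (3 * p - 1)) ≤ 2 * (p - 1) ^ 2 := by
    have h4 : u ≤ (8 * p - 62) / 30 := by linarith
    have h5 : u * (u + 1) ≤ (8 * p - 62) / 30 * ((8 * p - 62) / 30 + 1) := by
      gcongr
      linarith
    have h6 : u * (3 * p - 1) ≤ (8 * p - 62) / 30 * (3 * p - 1) := by
      gcongr
      linarith
    nlinarith
  have h7 : 2 / u * M - (M / (p - 1) ^ 2 / (4 * (1 / 10) * (1 - 1 / 10)) +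
      2 / (u + 1) * (M * (1 + 1 / (1 - 1 / 10) * ((3 * p - 1) / (p - 1) ^ 2)))) =
      M * (2 * (p - 1) ^ 2 - (25 / 9 * (u * (u + 1)) + 20 / 9 * (u * (3 * p - 1)))) /
        (u * (u + 1) * (p - 1) ^ 2) := by
    field_simp
    ring
  have h8 : 0 ≤ M * (2 * (p - 1) ^ 2 - (25 / 9 * (u * (u + 1)) + 20 / 9 * (u * (3 * p - 1)))) /
        (u * (u + 1) * (p - 1) ^ 2) :=
    div_nonneg (mul_nonneg hM (by linarith)) (by positivity)
  linarith

lemma exists_hasDistortedDensity {L : ℕ} [NeZero L] {S : Finset ℕ} (hS : 1 ∉ S)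
    (a : ℕ → ZMod L) {n : ℕ} (hn : 23 ≤ n) :
    ∃ (Q : ℕ) (M ε : ℝ), Q ∣ L ∧ (∀ p, p.Prime → p ∣ Q → p < n) ∧
      (∀ p, p.Prime → 23 ≤ p → p < n → p ^ L.factorization p ∣ Q) ∧ 0 ≤ M ∧
      ε + 2 / ((countCoprimeThirty n : ℝ) - 2) * M ≤ 1 / 2 ∧ HasDistortedDensity S a Q M ε := by
  induction n, hn using Nat.le_induction with
  | base =>
    refine ⟨1, 1, 0, one_dvd _, fun p hp h => ?_, fun p _ h1 h2 => by omega, zero_le_one, ?_,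
      hasDistortedDensity_one hS a⟩
    · exact absurd (Nat.dvd_one.mp h) hp.ne_one
    · norm_num [countCoprimeThirty]
  | succ n hn ih =>
    obtain ⟨Q, M, ε, hQL, hQn, hQ, hM, hε, H⟩ := ih
    have hu : (6 : ℝ) ≤ countCoprimeThirty n := by
      exact_mod_cast six_le_countCoprimeThirty hn
    by_cases hp : n.Prime
    · obtain ⟨hsucc, hle⟩ := countCoprimeThirty_of_prime hp (by omega)
      have hnQ : ¬ n ∣ Q := fun h => (hQn n hp h).false
      have hn1 : (23 : ℝ) ≤ n := by exact_mod_cast hn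
      have hle' : 30 * (countCoprimeThirty n : ℝ) + 2 ≤ 8 * n := by exact_mod_cast hle
      have hL : Q * n ^ L.factorization n ∣ L :=
        Nat.Coprime.mul_dvd_of_dvd_of_dvd
          (((Nat.Prime.coprime_iff_not_dvd hp).mpr hnQ).symm.pow_right _) hQL
          (Nat.ordProj_dvd L n)
      refine ⟨_, _, _, hL, fun p hp' h => ?_, fun p hp' h1 h2 => ?_, ?_, ?_,
        H.mul_prime_pow hp hnQ hL (δ := 1 / 10) (by norm_num) (by norm_num)⟩
      · rcases hp'.dvd_mul.mp h with h | h
        · exact (hQn p hp' h).trans n.lt_succ_self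
        · have := (Nat.prime_dvd_prime_iff_eq hp' hp).mp (hp'.dvd_of_dvd_pow h)
          omega
      · rcases Nat.lt_succ_iff_lt_or_eq.mp h2 with h | rfl
        · exact (hQ p hp' h1 h).mul_right _
        · exact dvd_mul_left _ _
      · have : (0 : ℝ) ≤ 3 * n - 1 := by linarith
        positivity
      · have h := distortion_potential_le (u := (countCoprimeThirty n : ℝ) - 2) hn1 (by linarith)
          (by linarith) hM
        rw [hsucc]
        push_cast
        rw [show (countCoprimeThirty n : ℝ) + 1 - 2 = countCoprimeThirty n - 2 + 1 by ring]
        linarith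
    · refine ⟨Q, M, ε, hQL, fun p hp' h => (hQn p hp' h).trans n.lt_succ_self,
        fun p hp' h1 h2 => hQ p hp' h1 ?_, hM, le_trans ?_ hε, H⟩
      · exact lt_of_le_of_ne (Nat.lt_succ_iff.mp h2) fun h => hp (h ▸ hp')
      · have h : (countCoprimeThirty n : ℝ) ≤ countCoprimeThirty (n + 1) := by
          exact_mod_cast countCoprimeThirty_le_succ n
        have : 0 < (countCoprimeThirty n : ℝ) - 2 := by linarith
        gcongr

/-- Every covering system of the integers has a modulus divisible by a prime `p ≤ 19`. -/
theorem covering_has_modulus_with_small_prime_factor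
    (S : Finset ℕ) (hS : ∀ m ∈ S, 1 < m) (a : ℕ → ℤ)
    (hcov : ∀ n : ℤ, ∃ m ∈ S, n ≡ a m [ZMOD (m : ℤ)]) :
    ∃ m ∈ S, ∃ p : ℕ, p.Prime ∧ p ≤ 19 ∧ p ∣ m := by
  by_contra! hcon
  have hlarge : ∀ m ∈ S, ∀ p : ℕ, p.Prime → p ∣ m → 23 ≤ p := by
    intro m hm p hp hpm
    have h19 : 19 < p := not_le.mp fun h => hcon m hm p hp h hpm
    by_contra! h
    interval_cases p <;> revert hp <;> norm_num
  set L := ∏ m ∈ S, m with hLdef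
  have hL0 : L ≠ 0 := prod_ne_zero_iff.mpr fun m hm => (zero_lt_one.trans (hS m hm)).ne'
  have : NeZero L := ⟨hL0⟩
  obtain ⟨Q, M, ε, hQL, -, hQ, hM, hε, f, hf, hf1, -, -, hfε⟩ :=
    exists_hasDistortedDensity (L := L) (n := L + 23) (fun h => (hS 1 h).false)
      (fun m => (a m : ZMod L)) (by omega)
  have hQ0 : Q ≠ 0 := ne_zero_of_dvd_ne_zero hL0 hQL
  have hdvd : ∀ m ∈ S, m ∣ Q := by
    intro m hm
    have hmL : m ∣ L := dvd_prod_of_mem _ hm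
    rw [Nat.dvd_iff_prime_pow_dvd_dvd]
    intro p k hp hk
    rcases Nat.eq_zero_or_pos k with rfl | hk0
    · simp
    have hpm : p ∣ m := (dvd_pow_self p hk0.ne').trans hk
    have hpL : p ≤ L := Nat.le_of_dvd (Nat.pos_of_ne_zero hL0) (hpm.trans hmL)
    exact (pow_dvd_pow p ((hp.pow_dvd_iff_le_factorization hL0).mp (hk.trans hmL))).trans
      (hQ p hp (hlarge m hm p hp hpm) (by omega))
  have hall (x : ZMod L) : coveredInd S (fun m => (a m : ZMod L)) Q x = 1 := by
    obtain ⟨z, rfl⟩ := ZMod.intCast_surjective x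
    obtain ⟨m, hm, hz⟩ := hcov z
    obtain ⟨c, hc⟩ := hz.symm.dvd
    refine if_pos ⟨m, hm, hdvd m hm, c, ?_⟩
    simpa using congrArg (Int.cast : ℤ → ZMod L) hc
  simp only [hall, mul_one, hf1] at hfε
  have hu : (6 : ℝ) ≤ countCoprimeThirty (L + 23) := by
    exact_mod_cast six_le_countCoprimeThirty (by omega)
  have : 0 ≤ 2 / ((countCoprimeThirty (L + 23) : ℝ) - 2) * M :=
    mul_nonneg (div_nonneg zero_le_two (by linarith)) hM
  linarith
end

section
/- There is no covering system of the integers all of whose moduli have every prime factor greater than 353. That is, if S is a finite set of integers greater than 1 such that every prime dividing an element of S exceeds 353, then for any choice of residues a : S → ℤ the union of the classes a_m mod m over m ∈ S is a proper subset of ℤ. -/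
namespace Covering

open Finset

/-- The average of `f` over `{0, …, T - 1}`. -/
noncomputable def mean (T : ℕ) (f : ℕ → ℝ) : ℝ := (∑ x ∈ range T, f x) / T

/-- The average of `f` over the points `x + M * t` with `t < N`. -/
noncomputable def fiberMean (M N : ℕ) (f : ℕ → ℝ) (x : ℕ) : ℝ := mean N fun t ↦ f (x + M * t)

theorem mean_mono {T : ℕ} {f g : ℕ → ℝ} (h : ∀ x, f x ≤ g x) : mean T f ≤ mean T g :=
  div_le_div_of_nonneg_right (sum_le_sum fun x _ ↦ h x) (Nat.cast_nonneg T)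

theorem mean_nonneg {T : ℕ} {f : ℕ → ℝ} (h : ∀ x, 0 ≤ f x) : 0 ≤ mean T f :=
  div_nonneg (sum_nonneg fun x _ ↦ h x) (Nat.cast_nonneg T)

theorem mean_add (T : ℕ) (f g : ℕ → ℝ) : mean T (fun x ↦ f x + g x) = mean T f + mean T g := by
  simp [mean, sum_add_distrib, add_div]

theorem mean_const_mul (T : ℕ) (c : ℝ) (f : ℕ → ℝ) : mean T (fun x ↦ c * f x) = c * mean T f := by
  simp [mean, ← mul_sum, mul_div_assoc]

theorem mean_sum {ι : Type*} (T : ℕ) (s : Finset ι) (f : ι → ℕ → ℝ) :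
    mean T (fun x ↦ ∑ i ∈ s, f i x) = ∑ i ∈ s, mean T (f i) := by
  simp only [mean, ← sum_div]
  rw [sum_comm]

theorem mean_const {T : ℕ} (hT : T ≠ 0) (c : ℝ) : mean T (fun _ ↦ c) = c := by
  have : (T : ℝ) ≠ 0 := by exact_mod_cast hT
  simp [mean]
  field_simp

theorem mean_comp_add {T : ℕ} {f : ℕ → ℝ} (hf : Function.Periodic f T) (c : ℕ) :
    mean T (fun x ↦ f (x + c)) = mean T f := by
  induction c with
  | zero => simp
  | succ c ih =>
    rw [← ih]
    unfold mean
    congr 1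
    have h := (sum_range_succ' (fun x ↦ f (x + c)) T).symm.trans
      (sum_range_succ (fun x ↦ f (x + c)) T)
    have h' : f (T + c) = f (0 + c) := by rw [add_comm T c, hf c, zero_add]
    simp only [h', add_left_inj] at h
    rw [← h]
    exact sum_congr rfl fun x _ ↦ by ring_nf

theorem periodic_of_dvd {α : Type*} {f : ℕ → α} {M N : ℕ} (hf : Function.Periodic f M)
    (h : M ∣ N) : Function.Periodic f N := by
  obtain ⟨k, rfl⟩ := h
  rw [mul_comm]
  exact hf.nat_mul k

theorem periodic_add_mul {α : Type*} {f : ℕ → α} {M : ℕ} (hf : Function.Periodic f M)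
    (x t : ℕ) : f (x + M * t) = f x := by
  rw [mul_comm]
  exact hf.nat_mul t x

theorem fiberMean_periodic {M N : ℕ} {f : ℕ → ℝ} (hf : Function.Periodic f (M * N)) :
    Function.Periodic (fiberMean M N f) M := by
  intro x
  have h : Function.Periodic (fun t ↦ f (x + M * t)) N := fun t ↦ by
    have := hf (x + M * t)
    rwa [show x + M * t + M * N = x + M * (t + N) by ring] at this
  rw [fiberMean, fiberMean, ← mean_comp_add h 1]
  congr 1
  funext t
  ring_nf

theorem mean_mul_fiberMean {T M N : ℕ} {f g : ℕ → ℝ} (hN : N ≠ 0) (hMT : M ∣ T)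
    (hf : Function.Periodic f M) (hg : Function.Periodic g T) :
    mean T (fun x ↦ f x * fiberMean M N g x) = mean T (fun x ↦ f x * g x) := by
  have hfg : Function.Periodic (fun x ↦ f x * g x) T := (periodic_of_dvd hf hMT).mul hg
  calc mean T (fun x ↦ f x * fiberMean M N g x)
      = mean N (fun t ↦ mean T fun x ↦ f (x + M * t) * g (x + M * t)) := by
        simp only [fiberMean, mean, periodic_add_mul hf, ← mul_div_assoc, mul_sum]
        simp only [← sum_div]
        rw [sum_comm, div_right_comm]
    _ = mean N (fun _ ↦ mean T fun x ↦ f x * g x) := by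
        congr 1
        funext t
        exact mean_comp_add hfg (M * t)
    _ = _ := mean_const hN _

open Classical in
/-- The indicator function of a set of natural numbers. -/
noncomputable def ind (s : Set ℕ) (x : ℕ) : ℝ := if x ∈ s then 1 else 0

theorem ind_nonneg (s : Set ℕ) (x : ℕ) : 0 ≤ ind s x := by
  unfold ind; split_ifs <;> norm_num

theorem ind_le_one (s : Set ℕ) (x : ℕ) : ind s x ≤ 1 := by
  unfold ind; split_ifs <;> norm_num

theorem ind_periodic {s : Set ℕ} {M : ℕ} (h : ∀ x, x + M ∈ s ↔ x ∈ s) :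
    Function.Periodic (ind s) M := fun x ↦ by
  by_cases hx : x ∈ s <;> simp [ind, h x, hx]

/-- The natural numbers in the residue class of `b` modulo `m`. -/
def resClass (m : ℕ) (b : ℤ) : Set ℕ := {x | (x : ℤ) ≡ b [ZMOD m]}

theorem add_mem_resClass {m M : ℕ} (h : m ∣ M) (b : ℤ) (x : ℕ) :
    x + M ∈ resClass m b ↔ x ∈ resClass m b := by
  obtain ⟨k, rfl⟩ := h
  simp [resClass, Int.ModEq]

theorem ind_resClass_periodic {m M : ℕ} (h : m ∣ M) (b : ℤ) :
    Function.Periodic (ind (resClass m b)) M := ind_periodic (add_mem_resClass h b)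

theorem fiberMean_resClass_le {M N d q : ℕ} (hd : d ∣ M) (hq : q ∣ N) (hN : N ≠ 0)
    (hMq : M.Coprime q) (b : ℤ) (x : ℕ) :
    fiberMean M N (ind (resClass (d * q) b)) x ≤ (q : ℝ)⁻¹ * ind (resClass d b) x := by
  classical
  obtain ⟨k, rfl⟩ := hq
  have hq0 : 0 < q := Nat.pos_of_ne_zero (left_ne_zero_of_mul hN)
  have hqk : (0 : ℝ) < (q * k : ℕ) := by exact_mod_cast Nat.pos_of_ne_zero hN
  have key : fiberMean M (q * k) (ind (resClass (d * q) b)) x =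
      #{t ∈ range (q * k) | x + M * t ∈ resClass (d * q) b} / (q * k : ℕ) := by
    simp only [fiberMean, mean, ind]
    rw [sum_boole]
  rw [key]
  by_cases hne : ∃ t, x + M * t ∈ resClass (d * q) b
  · obtain ⟨t₀, ht₀⟩ := hne
    have hx : x ∈ resClass d b := by
      have h : x + M * t₀ ∈ resClass d b := by
        refine Int.ModEq.of_dvd ?_ ht₀
        exact_mod_cast Dvd.intro q rfl
      rwa [add_mem_resClass (hd.mul_right t₀)] at h
    have hcard : #{t ∈ range (q * k) | x + M * t ∈ resClass (d * q) b} ≤ k := by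
      calc _ ≤ #{t ∈ range (q * k) | t ≡ t₀ [MOD q]} := by
            refine card_le_card (monotone_filter_right _ fun t _ ht ↦ ?_)
            have h1 : ((x + M * t : ℕ) : ℤ) ≡ ((x + M * t₀ : ℕ) : ℤ) [ZMOD ((d * q : ℕ) : ℤ)] :=
              Int.ModEq.trans ht (Int.ModEq.symm ht₀)
            have h2 : x + M * t ≡ x + M * t₀ [MOD q] :=
              ((Int.natCast_modEq_iff).1 h1).of_mul_left d
            have h3 : M * t ≡ M * t₀ [MOD q] := Nat.ModEq.add_left_cancel' x h2
            exact Nat.ModEq.cancel_left_of_coprime (Nat.Coprime.symm hMq) h3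
        _ = k := by
            rw [← Nat.count_eq_card_filter_range, Nat.count_modEq_card _ hq0]
            simp [hq0]
    rw [ind, if_pos hx, mul_one, div_le_iff₀ hqk]
    have : (0 : ℝ) < q := by exact_mod_cast hq0
    push_cast
    rw [← mul_assoc, inv_mul_cancel₀ this.ne', one_mul]
    exact_mod_cast hcard
  · push Not at hne
    rw [filter_false_of_mem fun t _ ↦ hne t]
    simpa using mul_nonneg (inv_nonneg.2 (Nat.cast_nonneg q)) (ind_nonneg _ _)

theorem distortion_pointwise {δ α θ : ℝ} (hδ : 0 < δ) (hδ' : δ < 1)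
    (hθ : θ = if α ≤ δ then 1 else δ / α) :
    0 ≤ θ ∧ θ ≤ 1 ∧ θ * α ≤ δ ∧
      α * (1 - θ) / (1 - θ * α) ≤ α ^ 2 / (4 * δ * (1 - δ)) := by
  have h1 : 0 < 1 - δ := by linarith
  split_ifs at hθ with h
  · subst hθ
    refine ⟨by norm_num, le_rfl, by linarith, ?_⟩
    simp only [sub_self, mul_zero, zero_div]
    positivity
  · push Not at h
    have hα' : 0 < α := hδ.trans h
    have hθα : θ * α = δ := by rw [hθ]; field_simp
    refine ⟨by rw [hθ]; positivity, by rw [hθ, div_le_one hα']; exact h.le, hθα.le, ?_⟩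
    rw [show α * (1 - θ) = α - δ by linarith, hθα, div_le_div_iff₀ h1 (by positivity)]
    nlinarith [mul_nonneg h1.le (sq_nonneg (α - 2 * δ))]

/-- Distorting a weight along the fibres so as to put less mass on the set `B`. -/
theorem exists_distortion {M N : ℕ} (hN : N ≠ 0) {δ : ℝ} (hδ : 0 < δ) (hδ' : δ < 1)
    {w : ℕ → ℝ} (hw : ∀ x, 0 ≤ w x) (hper : Function.Periodic w M) {B : Set ℕ}
    (hB : Function.Periodic (ind B) (M * N)) :
    ∃ w' : ℕ → ℝ, (∀ x, 0 ≤ w' x) ∧ Function.Periodic w' (M * N) ∧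
      (∀ x, w' x ≤ (1 - δ)⁻¹ * w x) ∧ (∀ x, fiberMean M N w' x = w x) ∧
      ∀ x, fiberMean M N (fun y ↦ w' y * ind B y) x ≤
        w x * (fiberMean M N (ind B) x ^ 2 / (4 * δ * (1 - δ))) := by
  classical
  set α := fiberMean M N (ind B)
  have hαper : Function.Periodic α M := fiberMean_periodic hB
  set θ : ℕ → ℝ := fun x ↦ if α x ≤ δ then 1 else δ / α x with hθ
  have hθper : Function.Periodic θ M := fun x ↦ by simp only [hθ, hαper x]
  have hpt := fun x ↦ distortion_pointwise (θ := θ x) hδ hδ' rfl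
  have hden : ∀ x, 0 < 1 - θ x * α x := fun x ↦ by linarith [(hpt x).2.2.1]
  have hfib : ∀ x, mean N (fun t ↦ ind B (x + M * t)) = α x := fun x ↦ rfl
  have hnum : ∀ x, 0 ≤ 1 - θ x * ind B x := fun x ↦ by
    nlinarith [ind_nonneg B x, ind_le_one B x, (hpt x).1, (hpt x).2.1]
  refine ⟨fun x ↦ w x / (1 - θ x * α x) * (1 - θ x * ind B x), fun x ↦ ?_, fun x ↦ ?_,
    fun x ↦ ?_, fun x ↦ ?_, fun x ↦ ?_⟩
  · exact mul_nonneg (div_nonneg (hw x) (hden x).le) (hnum x)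
  · have h := dvd_mul_right M N
    simp only [periodic_of_dvd hper h x, periodic_of_dvd hθper h x, periodic_of_dvd hαper h x, hB x]
  · calc w x / (1 - θ x * α x) * (1 - θ x * ind B x)
        ≤ w x / (1 - θ x * α x) * 1 := by
          refine mul_le_mul_of_nonneg_left ?_ (div_nonneg (hw x) (hden x).le)
          linarith [mul_nonneg (hpt x).1 (ind_nonneg B x)]
      _ ≤ w x / (1 - δ) := by
          rw [mul_one]
          exact div_le_div_of_nonneg_left (hw x) (by linarith) (by linarith [(hpt x).2.2.1])
      _ = _ := by rw [div_eq_inv_mul]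
  · simp only [fiberMean, periodic_add_mul hper, periodic_add_mul hθper, periodic_add_mul hαper]
    rw [mean_const_mul]
    simp only [sub_eq_add_neg, ← neg_mul]
    rw [mean_add, mean_const hN, mean_const_mul, hfib, neg_mul, ← sub_eq_add_neg]
    exact div_mul_cancel₀ _ (hden x).ne'
  · have hsq : ∀ y, ind B y * ind B y = ind B y := fun y ↦ by unfold ind; split_ifs <;> simp
    have e : ∀ t, w x / (1 - θ x * α x) * (1 - θ x * ind B (x + M * t)) * ind B (x + M * t) =
        w x / (1 - θ x * α x) * (1 - θ x) * ind B (x + M * t) := fun t ↦ by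
      linear_combination -(w x / (1 - θ x * α x)) * θ x * hsq (x + M * t)
    simp only [fiberMean, periodic_add_mul hper, periodic_add_mul hθper, periodic_add_mul hαper, e]
    rw [mean_const_mul, hfib]
    calc w x / (1 - θ x * α x) * (1 - θ x) * α x
        = w x * (α x * (1 - θ x) / (1 - θ x * α x)) := by ring
      _ ≤ _ := mul_le_mul_of_nonneg_left (hpt x).2.2.2 (hw x)

open ArithmeticFunction.omega in
/-- The bound used for the mass of a residue class modulo `m` under a distorted weight. -/
noncomputable def massBound (m : ℕ) : ℝ := (10 / 9 : ℝ) ^ (ω m) / m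

theorem massBound_one : massBound 1 = 1 := by simp [massBound]

theorem massBound_mul {m n : ℕ} (h : m.Coprime n) :
    massBound (m * n) = massBound m * massBound n := by
  rw [massBound, ArithmeticFunction.cardDistinctFactors_mul h, pow_add, massBound, massBound]
  push_cast
  exact mul_div_mul_comm _ _ _ _

theorem massBound_prime_pow {p k : ℕ} (hp : p.Prime) (hk : k ≠ 0) :
    massBound (p ^ k) = 10 / 9 * ((p : ℝ) ^ k)⁻¹ := by
  rw [massBound, ArithmeticFunction.cardDistinctFactors_apply_prime_pow hp hk]
  push_cast
  rw [pow_one, div_eq_mul_inv]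

theorem massBound_nonneg (m : ℕ) : 0 ≤ massBound m := by unfold massBound; positivity

/-- The sum of `massBound (lcm d e)` over pairs of divisors of `M`. -/
noncomputable def lcmSum (M : ℕ) : ℝ :=
  ∑ d ∈ M.divisors, ∑ e ∈ M.divisors, massBound (d.lcm e)

theorem lcmSum_nonneg (M : ℕ) : 0 ≤ lcmSum M :=
  sum_nonneg fun _ _ ↦ sum_nonneg fun _ _ ↦ massBound_nonneg _

theorem sum_divisors_mul_prime_pow {M p : ℕ} (γ : ℕ) (hp : p.Prime) (hMp : M.Coprime p)
    (f : ℕ → ℝ) :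
    ∑ m ∈ (M * p ^ γ).divisors, f m = ∑ d ∈ M.divisors, ∑ i ∈ range (γ + 1), f (d * p ^ i) := by
  have hco : M.Coprime (p ^ γ) := Nat.Coprime.pow_right γ hMp
  rw [Nat.divisors_mul, Finset.mul_def, sum_image hco.mul_injOn_divisors, sum_product]
  exact sum_congr rfl fun d _ ↦ Nat.sum_divisors_prime_pow (f := fun e ↦ f (d * e)) hp

theorem lcm_mul_prime_pow {d e p : ℕ} (hd : d.Coprime p) (he : e.Coprime p) (i j : ℕ) :
    (d * p ^ i).lcm (e * p ^ j) = d.lcm e * p ^ max i j := by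
  apply Nat.dvd_antisymm
  · exact Nat.lcm_dvd
      (mul_dvd_mul (Nat.dvd_lcm_left d e) (pow_dvd_pow p (le_max_left i j)))
      (mul_dvd_mul (Nat.dvd_lcm_right d e) (pow_dvd_pow p (le_max_right i j)))
  · have hco : (d.lcm e).Coprime (p ^ max i j) :=
      Nat.Coprime.pow_right _ ((Nat.Coprime.mul_left hd he).coprime_dvd_left
        (Nat.lcm_dvd_mul d e))
    refine hco.mul_dvd_of_dvd_of_dvd ?_ ?_
    · exact Nat.lcm_dvd ((dvd_mul_right d _).trans (Nat.dvd_lcm_left _ _))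
        ((dvd_mul_right e _).trans (Nat.dvd_lcm_right _ _))
    · rcases max_choice i j with h | h <;> rw [h]
      · exact (dvd_mul_left _ d).trans (Nat.dvd_lcm_left _ _)
      · exact (dvd_mul_left _ e).trans (Nat.dvd_lcm_right _ _)

theorem sum_sum_max_succ (f : ℕ → ℝ) (n : ℕ) :
    ∑ i ∈ range (n + 1), ∑ j ∈ range (n + 1), f (max i j) =
      ∑ i ∈ range n, ∑ j ∈ range n, f (max i j) + (2 * n + 1) * f n := by
  have h1 : ∀ i ∈ range n, f (max i n) = f n := fun i hi ↦ by
    rw [max_eq_right (mem_range.1 hi).le]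
  have h2 : ∀ i ∈ range n, f (max n i) = f n := fun i hi ↦ by
    rw [max_eq_left (mem_range.1 hi).le]
  simp only [sum_range_succ, sum_add_distrib]
  rw [sum_congr rfl h1, sum_congr rfl h2]
  simp
  ring

/-- The factor by which `lcmSum` may grow when a prime `p` is adjoined is `1 + growth p`. -/
noncomputable def growth (p : ℕ) : ℝ := 10 / 9 * ((3 * p - 1) / (p - 1) ^ 2)

theorem sum_massBound_max_le {p : ℕ} (hp : p.Prime) (γ : ℕ) :
    ∑ i ∈ range (γ + 1), ∑ j ∈ range (γ + 1), massBound (p ^ max i j) ≤ 1 + growth p := by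
  have hp1 : (0 : ℝ) < p - 1 := by
    have : (1 : ℝ) < p := by exact_mod_cast hp.one_lt
    linarith
  have hp0 : (0 : ℝ) < p := by linarith
  have key : ∑ i ∈ range (γ + 1), ∑ j ∈ range (γ + 1), massBound (p ^ max i j) =
      1 + growth p -
        10 / 9 * (2 / (p - 1) * γ + (3 * p - 1) / (p - 1) ^ 2) * ((p : ℝ) ^ γ)⁻¹ := by
    induction γ with
    | zero => simp [massBound_one, growth]
    | succ γ ih =>
      rw [sum_sum_max_succ (fun k ↦ massBound (p ^ k)), ih, massBound_prime_pow hp (by simp)]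
      push_cast
      rw [pow_succ]
      field_simp
      ring
  rw [key]
  have : 0 ≤ (3 * (p : ℝ) - 1) := by linarith
  have : 0 ≤ 10 / 9 * (2 / (p - 1) * γ + (3 * p - 1) / (p - 1) ^ 2) * ((p : ℝ) ^ γ)⁻¹ := by
    positivity
  linarith

theorem lcmSum_mul_prime_pow_le {M p : ℕ} (γ : ℕ) (hp : p.Prime) (hMp : M.Coprime p) :
    lcmSum (M * p ^ γ) ≤ lcmSum M * (1 + growth p) := by
  have hcop : ∀ d ∈ M.divisors, d.Coprime p := fun d hd ↦
    hMp.coprime_dvd_left (Nat.dvd_of_mem_divisors hd)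
  have key : lcmSum (M * p ^ γ) =
      lcmSum M * ∑ i ∈ range (γ + 1), ∑ j ∈ range (γ + 1), massBound (p ^ max i j) := by
    simp only [lcmSum, sum_divisors_mul_prime_pow γ hp hMp, sum_mul]
    refine sum_congr rfl fun d hd ↦ ?_
    rw [sum_comm]
    refine sum_congr rfl fun e he ↦ ?_
    rw [mul_sum]
    refine sum_congr rfl fun i _ ↦ ?_
    rw [mul_sum]
    refine sum_congr rfl fun j _ ↦ ?_
    rw [lcm_mul_prime_pow (hcop d hd) (hcop e he), massBound_mul]
    exact Nat.Coprime.pow_right _ ((Nat.Coprime.mul_left (hcop d hd) (hcop e he)).coprime_dvd_left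
        (Nat.lcm_dvd_mul d e))
  rw [key]
  exact mul_le_mul_of_nonneg_left (sum_massBound_max_le hp γ) (lcmSum_nonneg M)

theorem sum_inv_prime_pow_le {p : ℕ} (hp : p.Prime) (γ : ℕ) :
    ∑ j ∈ Icc 1 γ, ((p : ℝ) ^ j)⁻¹ ≤ 1 / (p - 1) := by
  have hp1 : (0 : ℝ) < p - 1 := by
    have : (1 : ℝ) < p := by exact_mod_cast hp.one_lt
    linarith
  have hp0 : (0 : ℝ) < p := by linarith
  have key : ∑ j ∈ Icc 1 γ, ((p : ℝ) ^ j)⁻¹ = 1 / (p - 1) - 1 / (p - 1) * ((p : ℝ) ^ γ)⁻¹ := by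
    induction γ with
    | zero => simp
    | succ γ ih =>
      rw [sum_Icc_succ_top (by simp), ih, pow_succ]
      field_simp
      ring
  rw [key]
  have : 0 ≤ 1 / (p - 1) * ((p : ℝ) ^ γ)⁻¹ := by positivity
  linarith

/-- A weight of total mass one, periodic modulo `M`, giving each residue class modulo a divisor
`m` of `M` mass at most `massBound m`. -/
structure IsSpread (T M : ℕ) (w : ℕ → ℝ) : Prop where
  nonneg : ∀ x, 0 ≤ w x
  periodic : Function.Periodic w M
  mean_eq_one : mean T w = 1
  mean_resClass_le : ∀ m, m ∣ M → ∀ b, mean T (fun x ↦ w x * ind (resClass m b) x) ≤ massBound m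

theorem exists_ind_resClass_mul_le (m n : ℕ) (b c : ℤ) :
    ∃ e, ∀ x, ind (resClass m b) x * ind (resClass n c) x ≤ ind (resClass (m.lcm n) e) x := by
  by_cases h : ∃ x₀, x₀ ∈ resClass m b ∧ x₀ ∈ resClass n c
  · obtain ⟨x₀, h1, h2⟩ := h
    refine ⟨x₀, fun x ↦ ?_⟩
    by_cases hb : x ∈ resClass m b
    · by_cases hc : x ∈ resClass n c
      · have : x ∈ resClass (m.lcm n) x₀ := by
          have := Int.modEq_and_modEq_iff_modEq_lcm.1
            ⟨Int.ModEq.trans hb (Int.ModEq.symm h1), Int.ModEq.trans hc (Int.ModEq.symm h2)⟩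
          simpa [resClass, Int.lcm] using this
        simp [ind, hb, hc, this]
      · rw [ind, ind, if_neg hc, mul_zero]; exact ind_nonneg _ _
    · rw [ind, if_neg hb, zero_mul]; exact ind_nonneg _ _
  · refine ⟨0, fun x ↦ ?_⟩
    push Not at h
    by_cases hb : x ∈ resClass m b
    · rw [ind, ind, if_neg (h x hb), mul_zero]; exact ind_nonneg _ _
    · rw [ind, if_neg hb, zero_mul]; exact ind_nonneg _ _

theorem IsSpread.mean_sq_le {T M : ℕ} {w : ℕ → ℝ} (hw : IsSpread T M w) {γ : ℕ}
    {u : ℕ → ℝ} (hu : ∀ j, 0 ≤ u j) (a : ℕ → ℕ → ℤ) {α : ℕ → ℝ} (hα0 : ∀ x, 0 ≤ α x)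
    (hα : ∀ x, α x ≤ ∑ d ∈ M.divisors, ∑ j ∈ Icc 1 γ, u j * ind (resClass d (a d j)) x) :
    mean T (fun x ↦ w x * α x ^ 2) ≤ (∑ j ∈ Icc 1 γ, u j) ^ 2 * lcmSum M := by
  choose b hb using exists_ind_resClass_mul_le
  let g (d i e j : ℕ) (x : ℕ) : ℝ :=
    (u i * u j) * (w x * ind (resClass (d.lcm e) (b d e (a d i) (a e j))) x)
  calc mean T (fun x ↦ w x * α x ^ 2)
      ≤ mean T (fun x ↦ ∑ d ∈ M.divisors, ∑ e ∈ M.divisors, ∑ i ∈ Icc 1 γ, ∑ j ∈ Icc 1 γ,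
          g d i e j x) := by
        refine mean_mono fun x ↦ ?_
        have h1 : α x ^ 2 ≤ (∑ d ∈ M.divisors, ∑ j ∈ Icc 1 γ,
            u j * ind (resClass d (a d j)) x) ^ 2 := pow_le_pow_left₀ (hα0 x) (hα x) 2
        refine (mul_le_mul_of_nonneg_left h1 (hw.nonneg x)).trans ?_
        rw [sq, sum_mul_sum, mul_sum]
        refine sum_le_sum fun d _ ↦ ?_
        rw [mul_sum]
        refine sum_le_sum fun e _ ↦ ?_
        rw [sum_mul_sum, mul_sum]
        refine sum_le_sum fun i _ ↦ ?_
        rw [mul_sum]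
        refine sum_le_sum fun j _ ↦ ?_
        have h2 := mul_le_mul_of_nonneg_left (hb d e (a d i) (a e j) x)
          (mul_nonneg (mul_nonneg (hu i) (hu j)) (hw.nonneg x))
        simp only [g]
        linarith
    _ = ∑ d ∈ M.divisors, ∑ e ∈ M.divisors, ∑ i ∈ Icc 1 γ, ∑ j ∈ Icc 1 γ,
          mean T (g d i e j) := by simp only [mean_sum]
    _ ≤ ∑ d ∈ M.divisors, ∑ e ∈ M.divisors, ∑ i ∈ Icc 1 γ, ∑ j ∈ Icc 1 γ,
          (u i * u j) * massBound (d.lcm e) := by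
        refine sum_le_sum fun d hd ↦ sum_le_sum fun e he ↦ sum_le_sum fun i _ ↦
          sum_le_sum fun j _ ↦ ?_
        simp only [g]
        rw [mean_const_mul]
        refine mul_le_mul_of_nonneg_left (hw.mean_resClass_le _ ?_ _) (mul_nonneg (hu i) (hu j))
        exact Nat.lcm_dvd (Nat.dvd_of_mem_divisors hd) (Nat.dvd_of_mem_divisors he)
    _ = _ := by
        simp only [← sum_mul, ← mul_sum]
        simp only [lcmSum, sq]

/-- The part of the union of the classes `a m` modulo `m`, over `m ∣ M * p ^ γ`, that involves
the prime `p`. -/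
def newPart (M p γ : ℕ) (a : ℕ → ℤ) : Set ℕ :=
  {x | ∃ d, d ∣ M ∧ ∃ j ∈ Icc 1 γ, x ∈ resClass (d * p ^ j) (a (d * p ^ j))}

theorem ind_newPart_periodic (M p γ : ℕ) (a : ℕ → ℤ) :
    Function.Periodic (ind (newPart M p γ a)) (M * p ^ γ) := by
  refine ind_periodic fun x ↦ exists_congr fun d ↦ and_congr_right fun hd ↦ exists_congr fun j ↦
    and_congr_right fun hj ↦ add_mem_resClass ?_ _ _
  exact mul_dvd_mul hd (pow_dvd_pow p (mem_Icc.1 hj).2)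

theorem ind_newPart_le {M : ℕ} (hM : M ≠ 0) (p γ : ℕ) (a : ℕ → ℤ) (x : ℕ) :
    ind (newPart M p γ a) x ≤ ∑ d ∈ M.divisors, ∑ j ∈ Icc 1 γ,
      ind (resClass (d * p ^ j) (a (d * p ^ j))) x := by
  by_cases hx : x ∈ newPart M p γ a
  · obtain ⟨d, hd, j, hj, h⟩ := id hx
    calc ind (newPart M p γ a) x ≤ ind (resClass (d * p ^ j) (a (d * p ^ j))) x := by
          simp [ind, hx, h]
      _ ≤ ∑ j ∈ Icc 1 γ, ind (resClass (d * p ^ j) (a (d * p ^ j))) x :=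
          single_le_sum (f := fun j ↦ ind (resClass (d * p ^ j) (a (d * p ^ j))) x)
            (fun _ _ ↦ ind_nonneg _ _) hj
      _ ≤ _ := single_le_sum
            (f := fun d ↦ ∑ j ∈ Icc 1 γ, ind (resClass (d * p ^ j) (a (d * p ^ j))) x)
            (fun _ _ ↦ sum_nonneg fun _ _ ↦ ind_nonneg _ _) (Nat.mem_divisors.2 ⟨hd, hM⟩)
  · rw [ind, if_neg hx]
    exact sum_nonneg fun _ _ ↦ sum_nonneg fun _ _ ↦ ind_nonneg _ _

theorem fiberMean_newPart_le {M p : ℕ} (γ : ℕ) (hM : M ≠ 0) (hp : p.Prime) (hMp : M.Coprime p)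
    (a : ℕ → ℤ) (x : ℕ) :
    fiberMean M (p ^ γ) (ind (newPart M p γ a)) x ≤ ∑ d ∈ M.divisors, ∑ j ∈ Icc 1 γ,
      ((p : ℝ) ^ j)⁻¹ * ind (resClass d (a (d * p ^ j))) x := by
  refine (mean_mono fun t ↦ ind_newPart_le hM p γ a (x + M * t)).trans ?_
  simp only [mean_sum]
  refine sum_le_sum fun d hd ↦ sum_le_sum fun j hj ↦ ?_
  have := fiberMean_resClass_le (Nat.dvd_of_mem_divisors hd)
    (pow_dvd_pow p (mem_Icc.1 hj).2) (pow_ne_zero γ hp.ne_zero) (Nat.Coprime.pow_right j hMp)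
    (a (d * p ^ j)) x
  rwa [Nat.cast_pow] at this

/-- The mass bound for the classes involving the prime `p`. -/
noncomputable def stepCost (p : ℕ) : ℝ := 25 / 9 / ((p : ℝ) - 1) ^ 2

theorem IsSpread.exists_step {T M p γ : ℕ} (hT : M * p ^ γ ∣ T) (hM : M ≠ 0) (hp : p.Prime)
    (hMp : M.Coprime p) {w : ℕ → ℝ} (hw : IsSpread T M w) (a : ℕ → ℤ) :
    ∃ w' : ℕ → ℝ, IsSpread T (M * p ^ γ) w' ∧
      (∀ f : ℕ → ℝ, Function.Periodic f M →
        mean T (fun x ↦ w' x * f x) = mean T (fun x ↦ w x * f x)) ∧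
      mean T (fun x ↦ w' x * ind (newPart M p γ a) x) ≤ stepCost p * lcmSum M := by
  have hN : p ^ γ ≠ 0 := pow_ne_zero γ hp.ne_zero
  have hMT : M ∣ T := (dvd_mul_right _ _).trans hT
  obtain ⟨w', h0, hper, hle, hfib, hB⟩ := exists_distortion hN (δ := 1 / 10) (by norm_num)
    (by norm_num) hw.nonneg hw.periodic (ind_newPart_periodic M p γ a)
  have hmean : ∀ f : ℕ → ℝ, Function.Periodic f M →
      mean T (fun x ↦ w' x * f x) = mean T (fun x ↦ w x * f x) := fun f hf ↦ by
    simp only [mul_comm _ (f _)]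
    rw [← mean_mul_fiberMean hN hMT hf (periodic_of_dvd hper hT)]
    simp only [hfib]
  refine ⟨w', ⟨h0, hper, ?_, ?_⟩, hmean, ?_⟩
  · have := hmean (fun _ ↦ 1) fun _ ↦ rfl
    simpa [hw.mean_eq_one] using this
  · intro m hm b
    obtain ⟨d, e, hd, he, rfl⟩ := Nat.dvd_mul.1 hm
    obtain ⟨j, hj, rfl⟩ := (Nat.dvd_prime_pow hp).1 he
    rcases Nat.eq_zero_or_pos j with rfl | hj0
    · rw [pow_zero, mul_one, hmean _ (ind_resClass_periodic hd b)]
      exact hw.mean_resClass_le d hd b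
    · have hper' : Function.Periodic (ind (resClass (d * p ^ j) b)) T :=
        ind_resClass_periodic (hm.trans hT) b
      calc mean T (fun x ↦ w' x * ind (resClass (d * p ^ j) b) x)
          ≤ mean T (fun x ↦ 10 / 9 * (w x * ind (resClass (d * p ^ j) b) x)) := by
            refine mean_mono fun x ↦ ?_
            have := mul_le_mul_of_nonneg_right (hle x) (ind_nonneg (resClass (d * p ^ j) b) x)
            norm_num at this ⊢
            linarith
        _ = 10 / 9 * mean T (fun x ↦
              w x * fiberMean M (p ^ γ) (ind (resClass (d * p ^ j) b)) x) := by
            rw [mean_const_mul, mean_mul_fiberMean hN hMT hw.periodic hper']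
        _ ≤ 10 / 9 * mean T (fun x ↦ ((p : ℝ) ^ j)⁻¹ * (w x * ind (resClass d b) x)) := by
            refine mul_le_mul_of_nonneg_left (mean_mono fun x ↦ ?_) (by norm_num)
            have := mul_le_mul_of_nonneg_left (fiberMean_resClass_le hd (pow_dvd_pow p hj) hN
              (Nat.Coprime.pow_right j hMp) b x) (hw.nonneg x)
            push_cast at this
            linarith
        _ ≤ 10 / 9 * (((p : ℝ) ^ j)⁻¹ * massBound d) := by
            rw [mean_const_mul]
            refine mul_le_mul_of_nonneg_left ?_ (by norm_num)
            exact mul_le_mul_of_nonneg_left (hw.mean_resClass_le d hd b) (by positivity)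
        _ = massBound (d * p ^ j) := by
            rw [massBound_mul (Nat.Coprime.pow_right j (hMp.coprime_dvd_left hd)),
              massBound_prime_pow hp hj0.ne']
            ring
  · have hα0 : ∀ x, 0 ≤ fiberMean M (p ^ γ) (ind (newPart M p γ a)) x :=
      fun x ↦ mean_nonneg fun t ↦ ind_nonneg _ _
    have hsum0 : 0 ≤ ∑ j ∈ Icc 1 γ, ((p : ℝ) ^ j)⁻¹ := sum_nonneg fun _ _ ↦ by positivity
    have hprod : Function.Periodic (fun x ↦ w' x * ind (newPart M p γ a) x) T :=
      periodic_of_dvd (hper.mul (ind_newPart_periodic M p γ a)) hT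
    calc mean T (fun x ↦ w' x * ind (newPart M p γ a) x)
        = mean T (fun x ↦ 1 * fiberMean M (p ^ γ) (fun y ↦ w' y * ind (newPart M p γ a) y) x) := by
          rw [mean_mul_fiberMean hN hMT (fun _ ↦ rfl) hprod]
          simp only [one_mul]
      _ ≤ mean T (fun x ↦ 25 / 9 *
            (w x * fiberMean M (p ^ γ) (ind (newPart M p γ a)) x ^ 2)) := by
          refine mean_mono fun x ↦ ?_
          have := hB x
          norm_num at this ⊢
          linarith
      _ ≤ 25 / 9 * ((∑ j ∈ Icc 1 γ, ((p : ℝ) ^ j)⁻¹) ^ 2 * lcmSum M) := by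
          rw [mean_const_mul]
          refine mul_le_mul_of_nonneg_left ?_ (by norm_num)
          exact hw.mean_sq_le (fun j ↦ by positivity) (fun d j ↦ a (d * p ^ j)) hα0
            (fiberMean_newPart_le γ hM hp hMp a)
      _ ≤ 25 / 9 * ((1 / (p - 1)) ^ 2 * lcmSum M) := by
          refine mul_le_mul_of_nonneg_left ?_ (by norm_num)
          exact mul_le_mul_of_nonneg_right (pow_le_pow_left₀ hsum0 (sum_inv_prime_pow_le hp γ) 2)
            (lcmSum_nonneg M)
      _ = _ := by
          rw [stepCost]
          generalize (p : ℝ) - 1 = y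
          ring

/-- The primes `p` with `353 < p < k`. -/
def largePrimes (k : ℕ) : Finset ℕ := {p ∈ range k | p.Prime ∧ 353 < p}

theorem mem_largePrimes {k p : ℕ} : p ∈ largePrimes k ↔ p < k ∧ p.Prime ∧ 353 < p := by
  simp [largePrimes]

theorem largePrimes_mono {k l : ℕ} (h : k ≤ l) : largePrimes k ⊆ largePrimes l := fun p hp ↦ by
  rw [mem_largePrimes] at hp ⊢
  exact ⟨hp.1.trans_le h, hp.2⟩

/-- The growth factors of the primes `p` with `353 < p < k` multiplied together. -/
noncomputable def growthProd (k : ℕ) : ℝ := ∏ p ∈ largePrimes k, (1 + growth p)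

theorem growth_nonneg {p : ℕ} (hp : p.Prime) : 0 ≤ growth p := by
  have : (1 : ℝ) ≤ p := by exact_mod_cast hp.one_lt.le
  have : (0 : ℝ) ≤ 3 * p - 1 := by linarith
  unfold growth
  positivity

theorem stepCost_nonneg (p : ℕ) : 0 ≤ stepCost p := by unfold stepCost; positivity

theorem one_le_growthProd (k : ℕ) : 1 ≤ growthProd k :=
  one_le_prod fun p hp ↦ by linarith [growth_nonneg (mem_largePrimes.1 hp).2.1]

theorem growthProd_mono {k l : ℕ} (h : k ≤ l) : growthProd k ≤ growthProd l := by
  rw [growthProd, growthProd, ← prod_sdiff (largePrimes_mono h)]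
  refine le_mul_of_one_le_left (zero_le_one.trans (one_le_growthProd k)) ?_
  exact one_le_prod fun p hp ↦ by
    linarith [growth_nonneg (mem_largePrimes.1 (sdiff_subset hp)).2.1]

/-- A bound for the growth factors of the primes in `[30 * n, 30 * (n + 1))`. -/
noncomputable def blockGrowth (n : ℕ) : ℝ := (45 * n + 1) / (405 * n ^ 2)

theorem coprime_thirty_of_prime {n r : ℕ} (hn : 0 < n) (h : (30 * n + r).Prime) :
    r.Coprime 30 := by
  have h1 : Nat.Coprime (30 * n + r) 30 := by
    refine h.coprime_iff_not_dvd.2 fun hd ↦ ?_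
    have := Nat.le_of_dvd (by norm_num) hd
    have : 30 * n + r = 30 := by lia
    rw [this] at h
    norm_num at h
  simpa using h1

theorem growth_le_blockGrowth {n r : ℕ} (hn : 0 < n) (hr : 0 < r) :
    growth (30 * n + r) ≤ blockGrowth n := by
  have hn' : (0 : ℝ) < n := by exact_mod_cast hn
  have hr' : (1 : ℝ) ≤ r := by exact_mod_cast hr
  unfold growth blockGrowth
  push_cast
  obtain ⟨y, hy⟩ : ∃ y : ℝ, y = 30 * n + r - 1 := ⟨_, rfl⟩
  have hy' : 30 * (n : ℝ) ≤ y := by linarith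
  have hy0 : 0 < y := by linarith
  rw [show 3 * (30 * (n : ℝ) + r) - 1 = 3 * y + 2 by linarith, ← hy]
  calc (10 / 9 : ℝ) * ((3 * y + 2) / y ^ 2) = 10 / 9 * (3 / y + 2 / y ^ 2) := by field_simp
    _ ≤ 10 / 9 * (3 / (30 * (n : ℝ)) + 2 / (30 * (n : ℝ)) ^ 2) := by gcongr
    _ = _ := by field_simp; ring

theorem stepCost_le_of_block {n r : ℕ} (hn : 0 < n) (hr : 0 < r) :
    stepCost (30 * n + r) ≤ 1 / (324 * n ^ 2) := by
  have hn' : (0 : ℝ) < n := by exact_mod_cast hn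
  have hr' : (1 : ℝ) ≤ r := by exact_mod_cast hr
  unfold stepCost
  push_cast
  calc 25 / 9 / (30 * (n : ℝ) + r - 1) ^ 2 ≤ 25 / 9 / (30 * n) ^ 2 := by
        gcongr
        linarith
    _ = _ := by field_simp; norm_num

theorem card_coprime_thirty : #{r ∈ range 30 | r.Coprime 30} = 8 := by decide

theorem growthProd_block_le {n : ℕ} (hn : 0 < n) :
    growthProd (30 * (n + 1)) ≤ growthProd (30 * n) * (1 + blockGrowth n) ^ 8 := by
  have hβ : 0 ≤ blockGrowth n := by unfold blockGrowth; positivity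
  rw [growthProd, growthProd, largePrimes, largePrimes, prod_filter, prod_filter,
    show 30 * (n + 1) = 30 * n + 30 by ring, prod_range_add, ← prod_filter]
  refine mul_le_mul_of_nonneg_left ?_ (zero_le_one.trans (one_le_growthProd (30 * n)))
  rw [← card_coprime_thirty, ← prod_const, prod_filter]
  refine prod_le_prod (fun r _ ↦ ?_) fun r _ ↦ ?_
  · split_ifs with h
    · linarith [growth_nonneg h.1]
    · norm_num
  · by_cases h : (30 * n + r).Prime ∧ 353 < 30 * n + r
    · have hr := coprime_thirty_of_prime hn h.1
      have hr0 : 0 < r := Nat.pos_of_ne_zero fun h0 ↦ by simp [h0] at hr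
      rw [if_pos h, if_pos hr]
      linarith [growth_le_blockGrowth hn hr0]
    · rw [if_neg h]
      split_ifs <;> linarith

/-- The total bound for the mass of the classes all of whose primes are less than `k`. -/
noncomputable def totalCost (k : ℕ) : ℝ := ∑ p ∈ largePrimes k, stepCost p * growthProd p

theorem totalCost_mono {k l : ℕ} (h : k ≤ l) : totalCost k ≤ totalCost l :=
  sum_le_sum_of_subset_of_nonneg (largePrimes_mono h) fun p _ _ ↦
    mul_nonneg (stepCost_nonneg p) (zero_le_one.trans (one_le_growthProd p))

theorem totalCost_block_le {n : ℕ} (hn : 0 < n) :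
    totalCost (30 * (n + 1)) ≤
      totalCost (30 * n) + 8 * (1 / (324 * n ^ 2) * growthProd (30 * (n + 1))) := by
  have hG : ∀ k, 0 ≤ growthProd k := fun k ↦ zero_le_one.trans (one_le_growthProd k)
  have hc : (0 : ℝ) ≤ 1 / (324 * n ^ 2) * growthProd (30 * (n + 1)) :=
    mul_nonneg (by positivity) (hG _)
  rw [totalCost, totalCost, largePrimes, largePrimes, sum_filter, sum_filter,
    show 30 * (n + 1) = 30 * n + 30 by ring, sum_range_add, ← sum_filter] at *
  refine add_le_add_right ?_ _
  rw [show (8 : ℝ) = (#{r ∈ range 30 | r.Coprime 30} : ℕ) by rw [card_coprime_thirty]; norm_num,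
    ← nsmul_eq_mul, ← sum_const, sum_filter]
  refine sum_le_sum fun r hr30 ↦ ?_
  by_cases h : (30 * n + r).Prime ∧ 353 < 30 * n + r
  · have hr := coprime_thirty_of_prime hn h.1
    have hr0 : 0 < r := Nat.pos_of_ne_zero fun h0 ↦ by simp [h0] at hr
    rw [if_pos h, if_pos hr]
    have hle : 30 * n + r ≤ 30 * n + 30 := by have := mem_range.1 hr30; lia
    exact mul_le_mul (stepCost_le_of_block hn hr0) (growthProd_mono hle) (hG _) (by positivity)
  · rw [if_neg h]
    split_ifs <;> linarith

theorem one_add_pow_eight_mul_le {β : ℝ} (h0 : 0 ≤ β) (h1 : β ≤ 1) :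
    (1 + β) ^ 8 * (1 - 8 * β) ≤ 1 := by
  have h : 1 - 8 * β ≤ (1 - β) ^ 8 := by
    have := one_add_mul_le_pow (a := -β) (by linarith) 8
    norm_num at this
    rw [sub_eq_add_neg 1 β]
    linarith
  calc (1 + β) ^ 8 * (1 - 8 * β) ≤ (1 + β) ^ 8 * (1 - β) ^ 8 :=
        mul_le_mul_of_nonneg_left h (by positivity)
    _ = (1 - β ^ 2) ^ 8 := by rw [← mul_pow]; ring
    _ ≤ 1 := pow_le_one₀ (by nlinarith) (by nlinarith)

theorem totalCost_add_le (n : ℕ) :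
    totalCost (30 * (n + 11)) + growthProd (30 * (n + 11)) / (n + 10) ≤ 1 / 10 := by
  induction n with
  | zero =>
    have : largePrimes (30 * (0 + 11)) = ∅ := by
      ext p
      simp only [mem_largePrimes, notMem_empty, iff_false]
      lia
    rw [totalCost, growthProd, this]
    norm_num
  | succ n ih =>
    obtain ⟨m, hm⟩ : ∃ m, m = n + 11 := ⟨_, rfl⟩
    have hm0 : 0 < m := by lia
    have hmn : (n : ℝ) = m - 11 := by rw [hm]; push_cast; ring
    have hm11 : (11 : ℝ) ≤ m := by rw [hm]; push_cast; linarith [(Nat.cast_nonneg n : (0 : ℝ) ≤ n)]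
    rw [show n + 1 + 11 = m + 1 by lia]
    rw [← hm] at ih
    push_cast
    rw [hmn] at ih ⊢
    have hG := one_le_growthProd (30 * (m + 1))
    have hβ0 : 0 ≤ blockGrowth m := by unfold blockGrowth; positivity
    have hβ : blockGrowth m ≤ 1 := by
      unfold blockGrowth
      rw [div_le_one (by positivity)]
      nlinarith
    have hG' : growthProd (30 * (m + 1)) * (1 - 8 * blockGrowth m) ≤ growthProd (30 * m) := by
      have h8 : 0 ≤ 1 - 8 * blockGrowth m := by
        unfold blockGrowth
        rw [sub_nonneg, mul_div_assoc', div_le_one (by positivity)]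
        nlinarith
      calc _ ≤ growthProd (30 * m) * (1 + blockGrowth m) ^ 8 * (1 - 8 * blockGrowth m) :=
            mul_le_mul_of_nonneg_right (growthProd_block_le hm0) h8
        _ = growthProd (30 * m) * ((1 + blockGrowth m) ^ 8 * (1 - 8 * blockGrowth m)) := by ring
        _ ≤ growthProd (30 * m) * 1 :=
            mul_le_mul_of_nonneg_left (one_add_pow_eight_mul_le hβ0 hβ)
              (zero_le_one.trans (one_le_growthProd _))
        _ = _ := mul_one _
    have hm1 : (0 : ℝ) < m - 1 := by linarith
    have key : 8 * (1 / (324 * (m : ℝ) ^ 2)) + 1 / m ≤ (1 - 8 * blockGrowth m) / (m - 1) := by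
      unfold blockGrowth
      have hm' : (0 : ℝ) < m := by linarith
      have e : (1 - 8 * ((45 * (m : ℝ) + 1) / (405 * m ^ 2))) / (m - 1) -
          (8 * (1 / (324 * (m : ℝ) ^ 2)) + 1 / m) =
          (35 * m + 2) / (405 * m ^ 2 * (m - 1)) := by
        field_simp
        ring
      have : 0 ≤ (35 * (m : ℝ) + 2) / (405 * m ^ 2 * (m - 1)) := by positivity
      linarith
    have h1 := totalCost_block_le hm0
    have h2 := mul_le_mul_of_nonneg_left key (zero_le_one.trans hG)
    have h3 := div_le_div_of_nonneg_right hG' hm1.le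
    rw [mul_div_assoc] at h3
    rw [show (m : ℝ) - 11 + 10 = m - 1 by ring] at ih
    rw [show (m : ℝ) - 11 + 1 + 10 = m by ring]
    have h4 : growthProd (30 * (m + 1)) * (8 * (1 / (324 * (m : ℝ) ^ 2)) + 1 / m) =
        8 * (1 / (324 * (m : ℝ) ^ 2) * growthProd (30 * (m + 1))) +
          growthProd (30 * (m + 1)) / m := by ring
    linarith

theorem totalCost_lt_one (k : ℕ) : totalCost k < 1 := by
  have h1 := totalCost_mono (show k ≤ 30 * (k + 11) by lia)
  have h2 := totalCost_add_le k
  have h3 : 0 ≤ growthProd (30 * (k + 11)) / ((k : ℝ) + 10) :=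
    div_nonneg (zero_le_one.trans (one_le_growthProd _)) (by positivity)
  linarith

/-- The product of `p ^ γ` over the primes `p` with `353 < p < k`. -/
def modulus (γ k : ℕ) : ℕ := ∏ p ∈ largePrimes k, p ^ γ

theorem modulus_ne_zero (γ k : ℕ) : modulus γ k ≠ 0 :=
  prod_ne_zero_iff.2 fun _ hp ↦ pow_ne_zero γ (mem_largePrimes.1 hp).2.1.ne_zero

theorem modulus_dvd (γ : ℕ) {k l : ℕ} (h : k ≤ l) : modulus γ k ∣ modulus γ l :=
  prod_dvd_prod_of_subset _ _ _ (largePrimes_mono h)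

theorem modulus_coprime {γ k : ℕ} (hk : k.Prime) : (modulus γ k).Coprime k :=
  Nat.Coprime.prod_left fun p hp ↦ by
    obtain ⟨h1, h2, _⟩ := mem_largePrimes.1 hp
    exact Nat.Coprime.pow_left γ ((Nat.coprime_primes h2 hk).2 h1.ne)

theorem largePrimes_succ_of_prime {k : ℕ} (hk : k.Prime ∧ 353 < k) :
    largePrimes (k + 1) = insert k (largePrimes k) := by
  rw [largePrimes, range_add_one, filter_insert, if_pos hk, largePrimes]

theorem largePrimes_succ_of_not {k : ℕ} (hk : ¬(k.Prime ∧ 353 < k)) :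
    largePrimes (k + 1) = largePrimes k := by
  rw [largePrimes, range_add_one, filter_insert, if_neg hk, largePrimes]

theorem notMem_largePrimes (k : ℕ) : k ∉ largePrimes k := by simp [mem_largePrimes]

theorem modulus_succ_of_prime (γ : ℕ) {k : ℕ} (hk : k.Prime ∧ 353 < k) :
    modulus γ (k + 1) = modulus γ k * k ^ γ := by
  rw [modulus, largePrimes_succ_of_prime hk, prod_insert (notMem_largePrimes k), mul_comm, modulus]

theorem modulus_succ_of_not (γ : ℕ) {k : ℕ} (hk : ¬(k.Prime ∧ 353 < k)) :
    modulus γ (k + 1) = modulus γ k := by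
  rw [modulus, largePrimes_succ_of_not hk, modulus]

theorem lcmSum_modulus_le (γ k : ℕ) : lcmSum (modulus γ k) ≤ growthProd k := by
  induction k with
  | zero => simp [lcmSum, modulus, growthProd, largePrimes, massBound_one]
  | succ k ih =>
    by_cases hk : k.Prime ∧ 353 < k
    · rw [modulus_succ_of_prime γ hk, growthProd, largePrimes_succ_of_prime hk,
        prod_insert (notMem_largePrimes k), mul_comm (1 + growth k)]
      exact (lcmSum_mul_prime_pow_le γ hk.1 (modulus_coprime hk.1)).trans
        (mul_le_mul_of_nonneg_right ih (by linarith [growth_nonneg hk.1]))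
    · rwa [modulus_succ_of_not γ hk, growthProd, largePrimes_succ_of_not hk]

/-- The union of the classes `a m` modulo `m` over the divisors `m ≠ 1` of `M`. -/
def covered (M : ℕ) (a : ℕ → ℤ) : Set ℕ := {x | ∃ m, m ∣ M ∧ m ≠ 1 ∧ x ∈ resClass m (a m)}

theorem ind_covered_periodic (M : ℕ) (a : ℕ → ℤ) : Function.Periodic (ind (covered M a)) M :=
  ind_periodic fun x ↦ exists_congr fun _ ↦ and_congr_right fun hm ↦ and_congr_right fun _ ↦
    add_mem_resClass hm _ x

theorem ind_covered_mul_le {M p : ℕ} (hp : p.Prime) (γ : ℕ) (a : ℕ → ℤ) (x : ℕ) :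
    ind (covered (M * p ^ γ) a) x ≤ ind (covered M a) x + ind (newPart M p γ a) x := by
  by_cases hx : x ∈ covered (M * p ^ γ) a
  · have : x ∈ covered M a ∨ x ∈ newPart M p γ a := by
      obtain ⟨m, hm, hm1, hxm⟩ := hx
      obtain ⟨d, e, hd, he, rfl⟩ := Nat.dvd_mul.1 hm
      obtain ⟨j, hj, rfl⟩ := (Nat.dvd_prime_pow hp).1 he
      rcases Nat.eq_zero_or_pos j with rfl | hj0
      · rw [pow_zero, mul_one] at hm1 hxm
        exact .inl ⟨d, hd, hm1, hxm⟩
      · exact .inr ⟨d, hd, j, mem_Icc.2 ⟨hj0, hj⟩, hxm⟩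
    rcases this with h | h
    · have : ind (covered M a) x = 1 := if_pos h
      linarith [ind_le_one (covered (M * p ^ γ) a) x, ind_nonneg (newPart M p γ a) x]
    · have : ind (newPart M p γ a) x = 1 := if_pos h
      linarith [ind_le_one (covered (M * p ^ γ) a) x, ind_nonneg (covered M a) x]
  · rw [ind, if_neg hx]
    exact add_nonneg (ind_nonneg _ _) (ind_nonneg _ _)

theorem exists_isSpread (γ K : ℕ) (a : ℕ → ℤ) {k : ℕ} (hk : k ≤ K) :
    ∃ w, IsSpread (modulus γ K) (modulus γ k) w ∧
      mean (modulus γ K) (fun x ↦ w x * ind (covered (modulus γ k) a) x) ≤ totalCost k := by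
  induction k with
  | zero =>
    have h1 : modulus γ 0 = 1 := by simp [modulus, largePrimes]
    have hmean := fun c ↦ mean_const (modulus_ne_zero γ K) c
    refine ⟨fun _ ↦ 1, ⟨fun _ ↦ zero_le_one, fun _ ↦ rfl, hmean 1, fun m hm b ↦ ?_⟩, ?_⟩
    · rw [h1, Nat.dvd_one] at hm
      rw [hm, massBound_one]
      refine (mean_mono fun x ↦ ?_).trans (hmean 1).le
      rw [one_mul]
      exact ind_le_one _ _
    · have h2 : ∀ x, ind (covered (modulus γ 0) a) x = 0 := fun x ↦
        if_neg fun ⟨m, hm, hm1, _⟩ ↦ hm1 (by rwa [h1, Nat.dvd_one] at hm)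
      simp only [h2, mul_zero, hmean]
      simp [totalCost, largePrimes]
  | succ k ih =>
    obtain ⟨w, hw, hle⟩ := ih (by lia)
    by_cases hp : k.Prime ∧ 353 < k
    · have hM := modulus_succ_of_prime γ hp
      obtain ⟨w', hw', hmean, hnew⟩ := hw.exists_step (p := k) (γ := γ)
        (hM ▸ modulus_dvd γ hk) (modulus_ne_zero γ k) hp.1 (modulus_coprime hp.1) a
      rw [hM]
      refine ⟨w', hw', ?_⟩
      rw [totalCost, largePrimes_succ_of_prime hp, sum_insert (notMem_largePrimes k), add_comm]
      calc mean (modulus γ K) (fun x ↦ w' x * ind (covered (modulus γ k * k ^ γ) a) x)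
          ≤ mean (modulus γ K) (fun x ↦ w' x * ind (covered (modulus γ k) a) x +
              w' x * ind (newPart (modulus γ k) k γ a) x) := by
            refine mean_mono fun x ↦ ?_
            rw [← mul_add]
            exact mul_le_mul_of_nonneg_left (ind_covered_mul_le hp.1 γ a x) (hw'.nonneg x)
        _ ≤ totalCost k + stepCost k * growthProd k := by
            rw [mean_add, hmean _ (ind_covered_periodic _ a)]
            exact add_le_add hle (hnew.trans
              (mul_le_mul_of_nonneg_left (lcmSum_modulus_le γ k) (stepCost_nonneg k)))
    · refine ⟨w, ?_⟩
      rw [modulus_succ_of_not γ hp, totalCost, largePrimes_succ_of_not hp]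
      exact ⟨hw, hle⟩

theorem exists_notMem_covered (γ k : ℕ) (a : ℕ → ℤ) : ∃ x, x ∉ covered (modulus γ k) a := by
  by_contra! h
  obtain ⟨w, hw, hle⟩ := exists_isSpread γ k a le_rfl
  have h1 : ∀ x, ind (covered (modulus γ k) a) x = 1 := fun x ↦ if_pos (h x)
  simp only [h1, mul_one, hw.mean_eq_one] at hle
  linarith [totalCost_lt_one k]

theorem dvd_modulus {m γ : ℕ} (hm0 : m ≠ 0) (hmγ : m ≤ γ)
    (hm : ∀ p : ℕ, p.Prime → p ∣ m → 353 < p) : m ∣ modulus γ (γ + 1) := by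
  conv_lhs => rw [← Nat.prod_factorization_pow_eq_self hm0]
  have hsub : m.primeFactors ⊆ largePrimes (γ + 1) := fun p hp ↦ by
    have h := Nat.mem_primeFactors.1 hp
    have := Nat.le_of_dvd (Nat.pos_of_ne_zero hm0) h.2.1
    exact mem_largePrimes.2 ⟨by lia, h.1, hm p h.1 h.2.1⟩
  refine Dvd.dvd.trans ?_ (prod_dvd_prod_of_subset _ _ _ hsub)
  exact prod_dvd_prod_of_dvd _ _ fun p _ ↦
    pow_dvd_pow p ((Nat.factorization_lt p hm0).le.trans hmγ)

end Covering

/-- There is no covering system of the integers all of whose moduli have every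
prime factor greater than `353`. -/
theorem no_covering_all_prime_factors_gt_353
    (S : Finset ℕ) (hS : ∀ m ∈ S, 1 < m)
    (hprime : ∀ m ∈ S, ∀ p : ℕ, p.Prime → p ∣ m → 353 < p)
    (a : ℕ → ℤ) :
    ¬ (∀ n : ℤ, ∃ m ∈ S, n ≡ a m [ZMOD (m : ℤ)]) := by
  intro h
  obtain ⟨x, hx⟩ := Covering.exists_notMem_covered (S.sup id) (S.sup id + 1) a
  obtain ⟨m, hm, hxm⟩ := h x
  exact hx ⟨m, Covering.dvd_modulus (by have := hS m hm; lia) (Finset.le_sup (f := id) hm)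
    (hprime m hm), (hS m hm).ne', hxm⟩
end
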